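/- There exists a constant C(p) > 0, depending only on p and independent of the choices of the intervals I(J), such that for every 0 < ε < 1, every martingale ε-sparse family 𝒮 of intervals in ℝ, and every interval L ⊆ ℝ: Σ_{I ∈ 𝒮, I ⊆ L} ⟨w̃⟩_I^p·⟨σ⟩_I·|I| ≤ C(p)·w̃(L)/(1−ε) and Σ_{I ∈ 𝒮, I ⊆ L} ⟨σ⟩_I^{p'}·⟨w̃⟩_I·|I| ≤ C(p)·σ(L)/(1−ε), where p' := p/(p−1). -/

import Mathlib

open MeasureTheory Set Filter

noncomputable section

namespace RTpaper

/-- The half-open interval `[a, b)` represented by the pair `(a, b)`. -/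
def ivSet (I : ℝ × ℝ) : Set ℝ := Set.Ico I.1 I.2

/-- The length of the interval represented by `I`. -/
def len (I : ℝ × ℝ) : ℝ := I.2 - I.1

/-- The middle triadic child of an interval. -/
def mid (I : ℝ × ℝ) : ℝ × ℝ := (I.1 + (I.2 - I.1) / 3, I.2 - (I.2 - I.1) / 3)

/-- The families `𝐊ᵢ` of the Reguera–Thiele construction. -/
def Kfam (k : ℕ) : ℕ → Set (ℝ × ℝ)
  | 0 => {((0 : ℝ), (1 : ℝ))}
  | (i + 1) =>
      {I | ∃ K ∈ Kfam k i, ∃ j : ℕ, j < 3 ^ (k - 1) ∧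
        I = ((mid K).1 + (j : ℝ) * ((3 : ℝ) ^ (1 - (k : ℤ)) * len (mid K)),
             (mid K).1 + ((j : ℝ) + 1) * ((3 : ℝ) ^ (1 - (k : ℤ)) * len (mid K)))}

/-- The families `𝐉ᵢ` (of interest for `i ≥ 1`). -/
def Jfam (k i : ℕ) : Set (ℝ × ℝ) := {J | ∃ K ∈ Kfam k (i - 1), J = mid K}

/-- The family `𝐊 = ⋃ᵢ 𝐊ᵢ`. -/
def KK (k : ℕ) : Set (ℝ × ℝ) := ⋃ i, Kfam k i

/-- The family `𝐉 = ⋃_{i ≥ 1} 𝐉ᵢ`. -/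
def JJ (k : ℕ) : Set (ℝ × ℝ) := ⋃ i, Jfam k (i + 1)

/-- The chosen triadic interval `I(J)` adjacent to `J` of length `3^{1-k}|J|`, encoded by a
choice function `ch` deciding, for each `J`, whether `I(J)` lies to the right (`true`) or to
the left (`false`) of `J`. -/
def IJ (k : ℕ) (ch : ℝ × ℝ → Bool) (J : ℝ × ℝ) : ℝ × ℝ :=
  if ch J then (J.2, J.2 + (3 : ℝ) ^ (1 - (k : ℤ)) * len J)
  else (J.1 - (3 : ℝ) ^ (1 - (k : ℤ)) * len J, J.1)

/-- The weight `w_k = Σ_{i ≥ 1} Σ_{J ∈ 𝐉ᵢ} (3^k/(3^{k-1}+1))^i · 1_{I(J)}`. -/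
def wgt (k : ℕ) (ch : ℝ × ℝ → Bool) (x : ℝ) : ℝ :=
  ∑' i : ℕ, ∑' J : ↥(Jfam k (i + 1)),
    Set.indicator (ivSet (IJ k ch (J : ℝ × ℝ)))
      (fun _ => ((3 : ℝ) ^ k / ((3 : ℝ) ^ (k - 1) + 1)) ^ (i + 1)) x

/-- The weight `σ_k = w_k^{1-p}` on `{w_k > 0}`, and `0` elsewhere. -/
def sgm (p : ℝ) (k : ℕ) (ch : ℝ × ℝ → Bool) (x : ℝ) : ℝ :=
  if 0 < wgt k ch x then wgt k ch x ^ (1 - p) else 0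

/-- `u(I) = ∫_I u`. -/
def mass (u : ℝ → ℝ) (I : ℝ × ℝ) : ℝ := ∫ x in ivSet I, u x

/-- `⟨u⟩_I = u(I)/|I|`. -/
def avg (u : ℝ → ℝ) (I : ℝ × ℝ) : ℝ := mass u I / len I

/-- `ch_𝐊(K)`: the members of `𝐊_{i+1}` contained in `K ∈ 𝐊ᵢ`. -/
def chK (k : ℕ) (K : ℝ × ℝ) : Set (ℝ × ℝ) :=
  {K' | ∃ i, K ∈ Kfam k i ∧ K' ∈ Kfam k (i + 1) ∧ ivSet K' ⊆ ivSet K}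

/-- Triadic intervals of `ℝ`. -/
def IsTriadic (I : ℝ × ℝ) : Prop :=
  ∃ n j : ℤ, I.1 = (j : ℝ) * (3 : ℝ) ^ (-n) ∧ I.2 = ((j : ℝ) + 1) * (3 : ℝ) ^ (-n)

/-- Maximal members of `S` strictly contained in `R`. -/
def maxIn (S : Set (ℝ × ℝ)) (R : ℝ × ℝ) : Set (ℝ × ℝ) :=
  {Q | Q ∈ S ∧ ivSet Q ⊂ ivSet R ∧
    ∀ Q' ∈ S, ivSet Q ⊆ ivSet Q' → ivSet Q' ⊂ ivSet R → ivSet Q' = ivSet Q}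

/-- Martingale `ε`-sparse families of (half-open) intervals. -/
def MSparse (ε : ℝ) (S : Set (ℝ × ℝ)) : Prop :=
  S.Countable ∧ (∀ I ∈ S, I.1 < I.2) ∧
    (∀ I ∈ S, ∀ J ∈ S, ivSet I ⊆ ivSet J ∨ ivSet J ⊆ ivSet I ∨ ivSet I ∩ ivSet J = ∅) ∧
    ∀ R ∈ S, (∑' Q : ↥(maxIn S R), len (Q : ℝ × ℝ)) ≤ ε * len R

/-- `Σ_{I ∈ F} ⟨u⟩_I^q · ⟨v⟩_I · |I|`. -/
def sumTest (q : ℝ) (u v : ℝ → ℝ) (F : Set (ℝ × ℝ)) : ℝ :=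
  ∑' I : ↥F, avg u (I : ℝ × ℝ) ^ q * avg v (I : ℝ × ℝ) * len (I : ℝ × ℝ)


/-- The global weight `w̃(x) = Σ_{k=4000}^∞ k^{-r}·w_k(x - 9^k)`, where for each `k` the
choices of the intervals `I(J)` are given by `ch k`. -/
def wGlob (r : ℝ) (ch : ℕ → ℝ × ℝ → Bool) (x : ℝ) : ℝ :=
  ∑' j : ℕ, ((j + 4000 : ℕ) : ℝ) ^ (-r) *
    wgt (j + 4000) (ch (j + 4000)) (x - (9 : ℝ) ^ (j + 4000))

/-- The global weight `σ(x) = Σ_{k=4000}^∞ σ_k(x - 9^k)`. -/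
def sGlob (p : ℝ) (ch : ℕ → ℝ × ℝ → Bool) (x : ℝ) : ℝ :=
  ∑' j : ℕ, sgm p (j + 4000) (ch (j + 4000)) (x - (9 : ℝ) ^ (j + 4000))

/-- A finite nested and sparse family. -/
structure Good (ε : ℝ) (F : Finset (ℝ × ℝ)) : Prop where
  pos : ∀ I ∈ F, I.1 < I.2
  nest : ∀ I ∈ F, ∀ J ∈ F, ivSet I ⊆ ivSet J ∨ ivSet J ⊆ ivSet I ∨ ivSet I ∩ ivSet J = ∅
  sp : ∀ I ∈ F, volume (⋃ I' ∈ F, ⋃ (_ : ivSet I' ⊂ ivSet I), ivSet I') ≤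
    ENNReal.ofReal (ε * len I)

lemma Good.mono {ε : ℝ} {F F' : Finset (ℝ × ℝ)} (h : Good ε F) (hF : F' ⊆ F) : Good ε F' := by
  refine ⟨fun I hI => h.pos I (hF hI), fun I hI J hJ => h.nest I (hF hI) J (hF hJ),
    fun I hI => le_trans (measure_mono ?_) (h.sp I (hF hI))⟩
  intro x hx
  simp only [mem_iUnion] at hx ⊢
  obtain ⟨J, hJ, h1, h2⟩ := hx
  exact ⟨J, hF hJ, h1, h2⟩

lemma vol_iv (I : ℝ × ℝ) : volume (ivSet I) = ENNReal.ofReal (len I) := by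
  simp [ivSet, len]

lemma meas_iv (I : ℝ × ℝ) : MeasurableSet (ivSet I) := measurableSet_Ico

lemma ivSet_inj {I J : ℝ × ℝ} (hI : I.1 < I.2) (h : ivSet I = ivSet J) : I = J := by
  have h1 := (Set.Ico_subset_Ico_iff hI).1 (le_of_eq h : Ico I.1 I.2 ⊆ Ico J.1 J.2)
  have hJ : J.1 < J.2 := by linarith [h1.1, h1.2]
  have h2 := (Set.Ico_subset_Ico_iff hJ).1 (le_of_eq h.symm : Ico J.1 J.2 ⊆ Ico I.1 I.2)
  exact Prod.ext (le_antisymm h2.1 h1.1) (le_antisymm h1.2 h2.2)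

lemma len_mono {I J : ℝ × ℝ} (hI : I.1 < I.2) (h : ivSet I ⊆ ivSet J) : len I ≤ len J := by
  have h1 := (Set.Ico_subset_Ico_iff hI).1 (h : Ico I.1 I.2 ⊆ Ico J.1 J.2)
  unfold len; linarith [h1.1, h1.2]

lemma mass_mono {u : ℝ → ℝ} (hu : ∀ x, 0 ≤ u x) (hui : ∀ I : ℝ × ℝ, IntegrableOn u (ivSet I))
    {I J : ℝ × ℝ} (h : ivSet I ⊆ ivSet J) : mass u I ≤ mass u J :=
  setIntegral_mono_set (hui J) (ae_of_all _ hu) (LE.le.eventuallyLE h)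

lemma mass_nonneg {u : ℝ → ℝ} (hu : ∀ x, 0 ≤ u x) (I : ℝ × ℝ) : 0 ≤ mass u I :=
  integral_nonneg hu

/-- every term is bounded below in terms of sub-intervals -/
lemma exists_max {q : ℝ} (hq : 0 < q) {u v : ℝ → ℝ} (hu : ∀ x, 0 ≤ u x) (hv : ∀ x, 0 ≤ v x)
    (hui : ∀ I : ℝ × ℝ, IntegrableOn u (ivSet I)) (hvi : ∀ I : ℝ × ℝ, IntegrableOn v (ivSet I))
    {S : Set (ℝ × ℝ)} {ε : ℝ} (hS : MSparse ε S) {L : ℝ × ℝ}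
    (hs : Summable (fun I : ↥{I | I ∈ S ∧ ivSet I ⊆ ivSet L} =>
      avg u (I : ℝ × ℝ) ^ q * avg v (I : ℝ × ℝ) * len (I : ℝ × ℝ)))
    {I I' : ℝ × ℝ} (hI : I ∈ S) (hIL : ivSet I ⊆ ivSet L) (hI' : I' ∈ S)
    (hu' : 0 < mass u I') (hv' : 0 < mass v I') (hII : ivSet I' ⊂ ivSet I) :
    ∃ Q ∈ maxIn S I, ivSet I' ⊆ ivSet Q := by
  obtain ⟨hc, hpos, hnest, hsp⟩ := hS
  set T : Set (ℝ × ℝ) := {Q | Q ∈ S ∧ ivSet I' ⊆ ivSet Q ∧ ivSet Q ⊂ ivSet I} with hT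
  have hlI : 0 < len I := sub_pos.2 (hpos I hI)
  set c : ℝ := (mass u I' / len I) ^ q * mass v I' with hcdef
  have hcpos : 0 < c := by positivity
  have hbound : ∀ Q ∈ T, c ≤ avg u Q ^ q * avg v Q * len Q := by
    rintro Q ⟨hQ, h1, h2⟩
    have hlQ : 0 < len Q := sub_pos.2 (hpos Q hQ)
    have e : avg u Q ^ q * avg v Q * len Q = avg u Q ^ q * mass v Q := by
      unfold avg; field_simp
    rw [e, hcdef]
    have hm1 := mass_mono hu hui h1
    have hm2 := mass_mono hv hvi h1
    have hl := len_mono (hpos Q hQ) h2.1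
    unfold avg
    have h0 := mass_nonneg hu Q
    gcongr
  have hfin : T.Finite := by
    have h0 := hs.tendsto_cofinite_zero
    have h1 := h0.eventually (gt_mem_nhds hcpos)
    rw [Filter.eventually_cofinite] at h1
    refine (h1.image Subtype.val).subset ?_
    intro Q hQ
    refine ⟨⟨Q, hQ.1, hQ.2.2.1.trans hIL⟩, ?_, rfl⟩
    simp only [Set.mem_ofPred_eq, not_lt]
    exact hbound Q hQ
  have hne : T.Nonempty := ⟨I', hI', Subset.rfl, hII⟩
  obtain ⟨Q, hQT, hQ⟩ := hfin.exists_maximalFor len T hne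
  refine ⟨Q, ⟨hQT.1, hQT.2.2, ?_⟩, hQT.2.1⟩
  intro Q' hQ' h1 h2
  have hT' : Q' ∈ T := ⟨hQ', hQT.2.1.trans h1, h2⟩
  have hlen : len Q' ≤ len Q := hQ hT' (len_mono (hpos Q hQT.1) h1)
  have h3 := (Set.Ico_subset_Ico_iff (hpos Q hQT.1)).1 (h1 : Ico Q.1 Q.2 ⊆ Ico Q'.1 Q'.2)
  unfold len at hlen
  have e1 : Q'.1 = Q.1 := by linarith [h3.1, h3.2]
  have e2 : Q'.2 = Q.2 := by linarith [h3.1, h3.2]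
  rw [Prod.ext e1 e2]

lemma vol_maxIn {S : Set (ℝ × ℝ)} {ε : ℝ} (hS : MSparse ε S) {R : ℝ × ℝ} (hR : R ∈ S) :
    volume (⋃ Q : ↥(maxIn S R), ivSet (Q : ℝ × ℝ)) ≤ ENNReal.ofReal (ε * len R) := by
  obtain ⟨hc, hpos, hnest, hsp⟩ := hS
  have : Countable ↥(maxIn S R) := (hc.mono (fun Q hQ => hQ.1)).to_subtype
  have hd : Pairwise (Function.onFun Disjoint (fun Q : ↥(maxIn S R) => ivSet (Q : ℝ × ℝ))) := by
    rintro ⟨Q, hQ⟩ ⟨Q', hQ'⟩ hne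
    simp only [Function.onFun]
    rcases hnest Q hQ.1 Q' hQ'.1 with h | h | h
    · exact absurd (Subtype.ext (ivSet_inj (hpos Q' hQ'.1) (hQ.2.2 Q' hQ'.1 h hQ'.2.1))).symm hne
    · exact absurd (Subtype.ext (ivSet_inj (hpos Q hQ.1) (hQ'.2.2 Q hQ.1 h hQ.2.1))) hne
    · exact Set.disjoint_iff_inter_eq_empty.2 h
  have h1 := measure_iUnion (μ := volume) hd (fun Q => meas_iv _)
  have h2 : volume (⋃ Q : ↥(maxIn S R), ivSet (Q : ℝ × ℝ)) ≤ ENNReal.ofReal (len R) := by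
    rw [← vol_iv]
    exact measure_mono (iUnion_subset fun Q => Q.2.2.1.1)
  simp only [vol_iv] at h1
  have hnn : ∀ Q : ↥(maxIn S R), 0 ≤ len (Q : ℝ × ℝ) :=
    fun Q => (sub_pos.2 (hpos _ Q.2.1)).le
  have hsum : Summable (fun Q : ↥(maxIn S R) => len (Q : ℝ × ℝ)) := by
    have := ENNReal.summable_toReal (f := fun Q : ↥(maxIn S R) => ENNReal.ofReal (len (Q : ℝ × ℝ)))
      (by rw [← h1]; exact ne_top_of_le_ne_top ENNReal.ofReal_ne_top h2)
    simpa [ENNReal.toReal_ofReal, hnn] using this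
  rw [h1, ← ENNReal.ofReal_tsum_of_nonneg hnn hsum]
  exact ENNReal.ofReal_le_ofReal (hsp R hR)

lemma reduce {q : ℝ} (hq : 0 < q) {u v : ℝ → ℝ} (hu : ∀ x, 0 ≤ u x) (hv : ∀ x, 0 ≤ v x)
    (hui : ∀ I : ℝ × ℝ, IntegrableOn u (ivSet I)) (hvi : ∀ I : ℝ × ℝ, IntegrableOn v (ivSet I))
    {S : Set (ℝ × ℝ)} {ε : ℝ} (hS : MSparse ε S) {L : ℝ × ℝ} {B : ℝ} (hB : 0 ≤ B)
    (H : ∀ F : Finset (ℝ × ℝ), Good ε F →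
      (∀ I ∈ F, ivSet I ⊆ ivSet L ∧ 0 < mass u I ∧ 0 < mass v I) →
      ∑ I ∈ F, avg u I ^ q * avg v I * len I ≤ B) :
    sumTest q u v {I | I ∈ S ∧ ivSet I ⊆ ivSet L} ≤ B := by
  classical
  unfold sumTest
  by_cases hs : Summable (fun I : ↥{I | I ∈ S ∧ ivSet I ⊆ ivSet L} =>
      avg u (I : ℝ × ℝ) ^ q * avg v (I : ℝ × ℝ) * len (I : ℝ × ℝ))
  swap
  · rw [tsum_eq_zero_of_not_summable hs]; exact hB
  refine hs.tsum_le_of_sum_le ?_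
  intro s
  set t := s.filter (fun I : ↥{I | I ∈ S ∧ ivSet I ⊆ ivSet L} => avg u (I : ℝ × ℝ) ^ q * avg v (I : ℝ × ℝ) * len (I : ℝ × ℝ) ≠ 0)
    with ht
  have e1 : ∑ I ∈ s, avg u (I : ℝ × ℝ) ^ q * avg v (I : ℝ × ℝ) * len (I : ℝ × ℝ) =
      ∑ I ∈ t.map (Function.Embedding.subtype _), avg u I ^ q * avg v I * len I := by
    rw [Finset.sum_map, ht]
    simp only [Function.Embedding.subtype_apply]
    exact (Finset.sum_filter_ne_zero s).symm
  rw [e1]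
  have hmem : ∀ I ∈ t.map (Function.Embedding.subtype _), I ∈ S ∧ ivSet I ⊆ ivSet L ∧
      0 < mass u I ∧ 0 < mass v I := by
    intro I hI
    simp only [Finset.mem_map, Function.Embedding.subtype_apply] at hI
    obtain ⟨⟨J, hJS, hJL⟩, hJ, rfl⟩ := hI
    rw [ht, Finset.mem_filter] at hJ
    have h := hJ.2
    simp only [ne_eq, mul_eq_zero, not_or] at h
    refine ⟨hJS, hJL, lt_of_le_of_ne (mass_nonneg hu _) ?_, lt_of_le_of_ne (mass_nonneg hv _) ?_⟩
    · intro h0; apply h.1.1; simp [avg, ← h0, Real.zero_rpow hq.ne']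
    · intro h0; apply h.1.2; simp [avg, ← h0]
  refine H _ ⟨fun I hI => hS.2.1 I (hmem I hI).1,
    fun I hI J hJ => hS.2.2.1 I (hmem I hI).1 J (hmem J hJ).1, ?_⟩ (fun I hI => (hmem I hI).2)
  intro I hI
  refine le_trans (measure_mono ?_) (vol_maxIn hS (hmem I hI).1)
  intro x hx
  simp only [mem_iUnion] at hx ⊢
  obtain ⟨J, hJ, h1, h2⟩ := hx
  obtain ⟨Q, hQ, hJQ⟩ := exists_max hq hu hv hui hvi hS hs (hmem I hI).1 (hmem I hI).2.1
    (hmem J hJ).1 (hmem J hJ).2.2.1 (hmem J hJ).2.2.2 h1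
  exact ⟨⟨Q, hQ⟩, hJQ h2⟩

/-- strict inclusion shrinks by ε. -/
lemma Good.chain {ε : ℝ} {F : Finset (ℝ × ℝ)} (h : Good ε F) (hε : 0 < ε) {I J : ℝ × ℝ}
    (hI : I ∈ F) (hJ : J ∈ F) (hs : ivSet J ⊂ ivSet I) : len J ≤ ε * len I := by
  have h1 : volume (ivSet J) ≤ ENNReal.ofReal (ε * len I) := by
    refine le_trans (measure_mono ?_) (h.sp I hI)
    intro x hx
    simp only [mem_iUnion]
    exact ⟨J, hJ, hs, hx⟩
  rw [vol_iv] at h1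
  have : 0 < len I := sub_pos.2 (h.pos I hI)
  exact (ENNReal.ofReal_le_ofReal_iff (by positivity)).1 h1

/-- The sum of inverse lengths through a point. -/
lemma Good.sum_inv {ε : ℝ} (hε : 0 < ε) (hε1 : ε < 1) {x T : ℝ} (hT : 0 < T) :
    ∀ (n : ℕ) (F : Finset (ℝ × ℝ)), F.card = n → Good ε F → (∀ I ∈ F, x ∈ ivSet I) →
    (∀ I ∈ F, T ≤ len I) → ∑ I ∈ F, 1 / len I ≤ 1 / ((1 - ε) * T) := by
  classical
  have h1ε : 0 < 1 - ε := by linarith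
  suffices H : ∀ (n : ℕ) (F : Finset (ℝ × ℝ)), F.card = n → Good ε F → (∀ I ∈ F, x ∈ ivSet I) →
      ∀ T : ℝ, 0 < T → (∀ I ∈ F, T ≤ len I) → ∑ I ∈ F, 1 / len I ≤ 1 / ((1 - ε) * T) from
    fun n F a b c d => H n F a b c T hT d
  intro n
  induction n with
  | zero =>
    intro F hF _ _ T hT _
    rw [Finset.card_eq_zero.1 hF]
    simp only [Finset.sum_empty]
    positivity
  | succ n ih =>
    intro F hF hG hx T hT hl
    have hne : F.Nonempty := Finset.card_pos.1 (by omega)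
    obtain ⟨I0, hI0, hmin⟩ := F.exists_min_image len hne
    have hl0 : 0 < len I0 := lt_of_lt_of_le hT (hl I0 hI0)
    rw [← Finset.add_sum_erase F _ hI0]
    have key := ih (F.erase I0) (by rw [Finset.card_erase_of_mem hI0]; omega)
      (hG.mono (Finset.erase_subset _ _)) (fun I hI => hx I (Finset.mem_of_mem_erase hI))
      (len I0 / ε) (by positivity) (by
        intro I hI
        have hIF := Finset.mem_of_mem_erase hI
        have hIne := Finset.ne_of_mem_erase hI
        have hsub : ivSet I0 ⊆ ivSet I := by
          rcases hG.nest I0 hI0 I hIF with h | h | h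
          · exact h
          · have h3 := (Set.Ico_subset_Ico_iff (hG.pos I hIF)).1
              (h : Ico I.1 I.2 ⊆ Ico I0.1 I0.2)
            have hm := hmin I hIF
            unfold len at hm
            have e1 : I.1 = I0.1 := by linarith [h3.1, h3.2]
            have e2 : I.2 = I0.2 := by linarith [h3.1, h3.2]
            exact absurd (Prod.ext e1 e2) hIne
          · exact absurd (show x ∈ ivSet I0 ∩ ivSet I from ⟨hx _ hI0, hx _ hIF⟩) (by simp [h])
        have hss : ivSet I0 ⊂ ivSet I := lt_of_le_of_ne hsub
          (fun he => hIne (ivSet_inj (hG.pos _ hI0) he).symm)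
        have := hG.chain hε hIF hI0 hss
        rw [div_le_iff₀ hε]; linarith)
    have h2 : 1 / len I0 + 1 / ((1 - ε) * (len I0 / ε)) = 1 / ((1 - ε) * len I0) := by
      field_simp; ring
    calc _ ≤ 1 / len I0 + 1 / ((1 - ε) * (len I0 / ε)) := by gcongr
      _ = 1 / ((1 - ε) * len I0) := h2
      _ ≤ _ := by
        have := hl I0 hI0
        gcongr

open Classical in
/-- number of intervals through a point in a range of scales -/
lemma Good.count {ε : ℝ} (hε : 0 < ε) (hε1 : ε < 1) {x s : ℝ} (hs : 0 < s) 
    {F : Finset (ℝ × ℝ)} (hG : Good ε F) (j : ℕ) :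
    ((F.filter (fun I => x ∈ ivSet I ∧ s ≤ len I ∧ len I < 3 ^ j * s)).card : ℝ)
      ≤ 3 * j / (1 - ε) := by
  have h1ε : 0 < 1 - ε := by linarith
  induction j with
  | zero =>
    have : F.filter (fun I => x ∈ ivSet I ∧ s ≤ len I ∧ len I < 3 ^ 0 * s) = ∅ := by
      apply Finset.filter_false_of_mem
      rintro I - ⟨-, h1, h2⟩
      linarith
    rw [this]; simp
  | succ j ih =>
    have hsub : F.filter (fun I => x ∈ ivSet I ∧ s ≤ len I ∧ len I < 3 ^ (j+1) * s) ⊆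
        F.filter (fun I => x ∈ ivSet I ∧ s ≤ len I ∧ len I < 3 ^ j * s) ∪
        F.filter (fun I => x ∈ ivSet I ∧ 3 ^ j * s ≤ len I ∧ len I < 3 ^ (j+1) * s) := by
      intro I hI
      simp only [Finset.mem_union, Finset.mem_filter] at hI ⊢
      rcases lt_or_ge (len I) (3 ^ j * s) with h | h
      · left; exact ⟨hI.1, hI.2.1, hI.2.2.1, h⟩
      · right; exact ⟨hI.1, hI.2.1, h, hI.2.2.2⟩
    have hc := (Finset.card_le_card hsub).trans (Finset.card_union_le _ _)
    have hc' : ((F.filter (fun I => x ∈ ivSet I ∧ s ≤ len I ∧ len I < 3 ^ (j+1) * s)).card : ℝ) ≤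
      ((F.filter (fun I => x ∈ ivSet I ∧ s ≤ len I ∧ len I < 3 ^ j * s)).card : ℝ) + 
      ((F.filter (fun I => x ∈ ivSet I ∧ 3 ^ j * s ≤ len I ∧ len I < 3 ^ (j+1) * s)).card : ℝ) := by
      exact_mod_cast hc
    set F' := F.filter (fun I => x ∈ ivSet I ∧ 3 ^ j * s ≤ len I ∧ len I < 3 ^ (j+1) * s) with hF'
    have hT : 0 < 3 ^ j * s := by positivity
    have h2 := Good.sum_inv hε hε1 (x := x) hT F'.card F' rfl (hG.mono (Finset.filter_subset _ _))
      (fun I hI => (Finset.mem_filter.1 hI).2.1) (fun I hI => (Finset.mem_filter.1 hI).2.2.1)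
    have h3 : ∑ I ∈ F', 1 / (3 ^ (j+1) * s) ≤ ∑ I ∈ F', 1 / len I := by
      apply Finset.sum_le_sum
      intro I hI
      have h4 := (Finset.mem_filter.1 hI).2.2
      have : 0 < len I := lt_of_lt_of_le hT h4.1
      have := h4.2.le
      gcongr
    rw [Finset.sum_const, nsmul_eq_mul] at h3
    have h4 : (F'.card : ℝ) ≤ 3 / (1 - ε) := by
      have h5 := h3.trans h2
      have h6 := mul_le_mul_of_nonneg_right h5 (show 0 ≤ 3 ^ (j+1) * s by positivity)
      have e1 : (F'.card : ℝ) * (1 / (3 ^ (j+1) * s)) * (3 ^ (j+1) * s) = F'.card := by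
        field_simp
      have e2 : 1 / ((1 - ε) * (3 ^ j * s)) * (3 ^ (j+1) * s) = 3 / (1 - ε) := by
        field_simp; ring
      rwa [e1, e2] at h6
    calc _ ≤ 3 * (j:ℝ) / (1 - ε) + 3 / (1 - ε) := by linarith
      _ = _ := by push_cast; ring

lemma powint {s A : ℝ} (hs : -1 < s) (hA : 0 ≤ A) :
    ∫⁻ t in Ioo 0 A, ENNReal.ofReal (t ^ s) = ENNReal.ofReal (A ^ (s + 1) / (s + 1)) := by
  have h1 : IntervalIntegrable (fun t : ℝ => t ^ s) volume 0 A :=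
    intervalIntegral.intervalIntegrable_rpow' hs
  have h2 : IntegrableOn (fun t : ℝ => t ^ s) (Ioo 0 A) :=
    ((intervalIntegrable_iff_integrableOn_Ioo_of_le hA).1 h1)
  rw [← ofReal_integral_eq_lintegral_ofReal h2]
  · congr 1
    rw [← integral_Ioc_eq_integral_Ioo, ← intervalIntegral.integral_of_le hA,
      integral_rpow (Or.inl hs), Real.zero_rpow (by linarith)]
    simp
  · refine (ae_restrict_iff' measurableSet_Ioo).2 (ae_of_all _ fun t ht => ?_)
    exact Real.rpow_nonneg ht.1.le _

/-- The sparse part of `I`. -/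
def Epart (F : Finset (ℝ × ℝ)) (I : ℝ × ℝ) : Set ℝ :=
  ivSet I \ ⋃ I' ∈ F, ⋃ (_ : ivSet I' ⊂ ivSet I), ivSet I'

lemma meas_union (F : Finset (ℝ × ℝ)) (I : ℝ × ℝ) :
    MeasurableSet (⋃ I' ∈ F, ⋃ (_ : ivSet I' ⊂ ivSet I), ivSet I') :=
  Finset.measurableSet_biUnion _ fun I' _ => MeasurableSet.iUnion fun _ => meas_iv I'

lemma meas_E (F : Finset (ℝ × ℝ)) (I : ℝ × ℝ) : MeasurableSet (Epart F I) :=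
  (meas_iv I).diff (meas_union F I)

lemma Good.E_vol {ε : ℝ} (hε : 0 < ε) (hε1 : ε < 1) {F : Finset (ℝ × ℝ)} (h : Good ε F)
    {I : ℝ × ℝ} (hI : I ∈ F) : ENNReal.ofReal ((1 - ε) * len I) ≤ volume (Epart F I) := by
  have hl : 0 < len I := sub_pos.2 (h.pos I hI)
  have h1 := h.sp I hI
  have h2 : volume (ivSet I) ≤ volume (Epart F I) +
      volume (⋃ I' ∈ F, ⋃ (_ : ivSet I' ⊂ ivSet I), ivSet I') := by
    refine (measure_mono ?_).trans (measure_union_le _ _)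
    intro x hx
    by_cases hx' : x ∈ ⋃ I' ∈ F, ⋃ (_ : ivSet I' ⊂ ivSet I), ivSet I'
    · exact Or.inr hx'
    · exact Or.inl ⟨hx, hx'⟩
  rw [vol_iv] at h2
  have h3 := h2.trans (add_le_add_right h1 _)
  have e : ENNReal.ofReal (len I) =
      ENNReal.ofReal ((1 - ε) * len I) + ENNReal.ofReal (ε * len I) := by
    rw [← ENNReal.ofReal_add (by nlinarith) (by positivity)]; congr 1; ring
  rw [e] at h3
  exact (ENNReal.add_le_add_iff_right ENNReal.ofReal_ne_top).1 h3

lemma Good.E_disj {ε : ℝ} {F : Finset (ℝ × ℝ)} (h : Good ε F)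
    {I J : ℝ × ℝ} (hI : I ∈ F) (hJ : J ∈ F) (hne : I ≠ J) :
    Disjoint (Epart F I) (Epart F J) := by
  have aux : ∀ I J : ℝ × ℝ, I ∈ F → J ∈ F → I ≠ J → ivSet I ⊆ ivSet J →
      Disjoint (Epart F I) (Epart F J) := by
    intro I J hI hJ hne hs
    rw [Set.disjoint_left]
    intro x hx hx'
    apply hx'.2
    simp only [mem_iUnion]
    exact ⟨I, hI, lt_of_le_of_ne hs (fun he => hne (ivSet_inj (h.pos _ hI) he)), hx.1⟩
  rcases h.nest I hI J hJ with h1 | h1 | h1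
  · exact aux I J hI hJ hne h1
  · exact (aux J I hJ hI hne.symm h1).symm
  · exact (Set.disjoint_iff_inter_eq_empty.2 h1).mono sdiff_subset sdiff_subset

lemma single_weak {f : ℝ → ℝ} (hf : ∀ x, 0 ≤ f x) (hm : Measurable f) {I : ℝ × ℝ}
    (hI : I.1 < I.2) (hfi : IntegrableOn f (ivSet I)) {t : ℝ} (ht : 0 < t) (h : t < avg f I) :
    volume (ivSet I) ≤ ENNReal.ofReal (2 / t) *
      ∫⁻ x in ivSet I ∩ {x | t / 2 < f x}, ENNReal.ofReal (f x) := by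
  have hl : 0 < len I := sub_pos.2 hI
  have hms : MeasurableSet {x | t / 2 < f x} := measurableSet_lt measurable_const hm
  have h1 : ENNReal.ofReal (t * len I) ≤ ∫⁻ x in ivSet I, ENNReal.ofReal (f x) := by
    rw [← ofReal_integral_eq_lintegral_ofReal hfi (ae_of_all _ hf)]
    apply ENNReal.ofReal_le_ofReal
    have := (lt_div_iff₀ hl).1 h
    exact this.le
  have h2 : ∫⁻ x in ivSet I, ENNReal.ofReal (f x) ≤
      (∫⁻ x in ivSet I ∩ {x | t / 2 < f x}, ENNReal.ofReal (f x)) +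
        ENNReal.ofReal (t / 2 * len I) := by
    have e : ENNReal.ofReal (t / 2 * len I) = ∫⁻ x in ivSet I, ENNReal.ofReal (t / 2) := by
      rw [setLIntegral_const, vol_iv, ENNReal.ofReal_mul (by positivity)]
    have e2 : (∫⁻ x in ivSet I ∩ {x | t / 2 < f x}, ENNReal.ofReal (f x)) =
        ∫⁻ x in ivSet I, indicator {x | t / 2 < f x} (fun x => ENNReal.ofReal (f x)) x := by
      rw [lintegral_indicator hms, Measure.restrict_restrict hms, inter_comm]
    rw [e, e2, ← lintegral_add_right _ measurable_const]
    apply lintegral_mono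
    intro x
    by_cases hx : t / 2 < f x
    · simp only [indicator, Set.mem_ofPred_eq, hx, if_true]; exact le_self_add
    · simp only [indicator, Set.mem_ofPred_eq, hx, if_false, zero_add]
      exact ENNReal.ofReal_le_ofReal (not_lt.1 hx)
  have h3 : ENNReal.ofReal (t / 2 * len I) ≤
      ∫⁻ x in ivSet I ∩ {x | t / 2 < f x}, ENNReal.ofReal (f x) := by
    have h4 := h1.trans h2
    have e : ENNReal.ofReal (t * len I) =
        ENNReal.ofReal (t / 2 * len I) + ENNReal.ofReal (t / 2 * len I) := by
      rw [← ENNReal.ofReal_add (by positivity) (by positivity)]; congr 1; ring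
    rw [e] at h4
    exact (ENNReal.add_le_add_iff_right ENNReal.ofReal_ne_top).1 h4
  calc volume (ivSet I) = ENNReal.ofReal (2 / t) * ENNReal.ofReal (t / 2 * len I) := by
        rw [vol_iv, ← ENNReal.ofReal_mul (by positivity)]; congr 1; field_simp
    _ ≤ _ := by gcongr

open Classical in
lemma Good.weak {ε : ℝ} {F : Finset (ℝ × ℝ)} (h : Good ε F)
    {f : ℝ → ℝ} (hf : ∀ x, 0 ≤ f x) (hm : Measurable f) {L : ℝ × ℝ}
    (hL : ∀ I ∈ F, ivSet I ⊆ ivSet L) (hfi : IntegrableOn f (ivSet L)) {t : ℝ} (ht : 0 < t) :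
    ∑ I ∈ F.filter (fun I => t < avg f I), volume (Epart F I) ≤ ENNReal.ofReal (2 / t) *
      ∫⁻ x in ivSet L ∩ {x | t / 2 < f x}, ENNReal.ofReal (f x) := by
  have hms : MeasurableSet {x | t / 2 < f x} := measurableSet_lt measurable_const hm
  set G := F.filter (fun I => t < avg f I) with hG
  have hGF : ∀ I ∈ G, I ∈ F := fun I hI => (Finset.mem_filter.1 hI).1
  set M := G.filter (fun I => ∀ J ∈ G, ivSet I ⊆ ivSet J → J = I) with hM
  have hMG : ∀ I ∈ M, I ∈ G := fun I hI => (Finset.mem_filter.1 hI).1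
  have hcov : ∀ I ∈ G, ∃ J ∈ M, ivSet I ⊆ ivSet J := by
    intro I hI
    obtain ⟨J, hJ, hmax⟩ := (G.filter (fun J => ivSet I ⊆ ivSet J)).exists_max_image len
      ⟨I, Finset.mem_filter.2 ⟨hI, Subset.rfl⟩⟩
    rw [Finset.mem_filter] at hJ
    refine ⟨J, Finset.mem_filter.2 ⟨hJ.1, ?_⟩, hJ.2⟩
    intro K hK hJK
    have h1 := hmax K (Finset.mem_filter.2 ⟨hK, hJ.2.trans hJK⟩)
    have h3 := (Set.Ico_subset_Ico_iff (h.pos J (hGF J hJ.1))).1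
      (hJK : Ico J.1 J.2 ⊆ Ico K.1 K.2)
    unfold len at h1
    exact Prod.ext (by linarith [h3.1, h3.2]) (by linarith [h3.1, h3.2])
  have hdisj : ∀ I ∈ M, ∀ J ∈ M, I ≠ J → Disjoint (ivSet I) (ivSet J) := by
    intro I hI J hJ hne
    rcases h.nest I (hGF I (hMG I hI)) J (hGF J (hMG J hJ)) with h1 | h1 | h1
    · exact absurd ((Finset.mem_filter.1 hI).2 J (hMG J hJ) h1).symm hne
    · exact absurd ((Finset.mem_filter.1 hJ).2 I (hMG I hI) h1) hne
    · exact Set.disjoint_iff_inter_eq_empty.2 h1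
  calc ∑ I ∈ G, volume (Epart F I) = volume (⋃ I ∈ G, Epart F I) := by
        rw [measure_biUnion_finset (fun I hI J hJ hne => h.E_disj (hGF I hI) (hGF J hJ) hne)
          (fun I _ => meas_E F I)]
    _ ≤ volume (⋃ I ∈ M, ivSet I) := by
        apply measure_mono
        intro x hx
        simp only [mem_iUnion] at hx ⊢
        obtain ⟨I, hI, hx⟩ := hx
        obtain ⟨J, hJ, hIJ⟩ := hcov I hI
        exact ⟨J, hJ, hIJ hx.1⟩
    _ ≤ ∑ I ∈ M, volume (ivSet I) := measure_biUnion_finset_le _ _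
    _ ≤ ∑ I ∈ M, ENNReal.ofReal (2 / t) *
          ∫⁻ x in ivSet I ∩ {x | t / 2 < f x}, ENNReal.ofReal (f x) := by
        apply Finset.sum_le_sum
        intro I hI
        have hIG := hMG I hI
        exact single_weak hf hm (h.pos I (hGF I hIG)) (hfi.mono_set (hL I (hGF I hIG))) ht
          (Finset.mem_filter.1 hIG).2
    _ = ENNReal.ofReal (2 / t) *
          ∫⁻ x in ⋃ I ∈ M, (ivSet I ∩ {x | t / 2 < f x}), ENNReal.ofReal (f x) := by
        rw [← Finset.mul_sum, lintegral_biUnion_finset]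
        · intro I hI J hJ hne
          exact (hdisj I hI J hJ hne).mono inter_subset_left inter_subset_left
        · intro I _; exact (meas_iv I).inter hms
    _ ≤ _ := by
        gcongr
        intro x hx
        simp only [mem_iUnion] at hx
        obtain ⟨I, hI, hx⟩ := hx
        exact ⟨hL I (hGF I (hMG I hI)) hx.1, hx.2⟩

/-- Carleson embedding for sparse nested families. -/
lemma Good.embed {ε : ℝ} (hε : 0 < ε) (hε1 : ε < 1) {F : Finset (ℝ × ℝ)} (h : Good ε F)
    {f : ℝ → ℝ} (hf : ∀ x, 0 ≤ f x) (hm : Measurable f) {L : ℝ × ℝ} {q : ℝ} (hq : 1 < q)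
    (hL : ∀ I ∈ F, ivSet I ⊆ ivSet L) (hfi : IntegrableOn f (ivSet L))
    (hfq : IntegrableOn (fun x => f x ^ q) (ivSet L)) :
    ∑ I ∈ F, avg f I ^ q * len I ≤ (q * 2 ^ q / (q - 1)) * (∫ x in ivSet L, f x ^ q) / (1 - ε) := by
  classical
  have h1ε : 0 < 1 - ε := by linarith
  have hq1 : 0 < q - 1 := by linarith
  have hA : ∀ I ∈ F, 0 ≤ avg f I := fun I hI =>
    div_nonneg (mass_nonneg hf I) (sub_pos.2 (h.pos I hI)).le
  -- main ENNReal inequality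
  have main : ∑ I ∈ F, ENNReal.ofReal (avg f I ^ q) * volume (Epart F I) ≤
      ENNReal.ofReal (q * 2 ^ q / (q - 1)) * ∫⁻ x in ivSet L, ENNReal.ofReal (f x ^ q) := by
    have s1 : ∀ I ∈ F, ENNReal.ofReal (avg f I ^ q) * volume (Epart F I) =
        ENNReal.ofReal q * ∫⁻ t in Ioi (0:ℝ), ENNReal.ofReal (t ^ (q - 1)) *
          (if t < avg f I then volume (Epart F I) else 0) := by
      intro I hI
      have e := powint (s := q - 1) (A := avg f I) (by linarith) (hA I hI)
      have e2 : ∫⁻ t in Ioi (0:ℝ), ENNReal.ofReal (t ^ (q - 1)) *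
          (if t < avg f I then volume (Epart F I) else 0) =
          (∫⁻ t in Ioo 0 (avg f I), ENNReal.ofReal (t ^ (q - 1))) * volume (Epart F I) := by
        rw [← lintegral_mul_const _ (by fun_prop), ← lintegral_indicator measurableSet_Ioi,
          ← lintegral_indicator measurableSet_Ioo]
        congr 1
        ext t
        simp only [indicator, mem_Ioi, mem_Ioo]
        by_cases h0 : 0 < t <;> by_cases h1 : t < avg f I <;> simp [h0, h1]
      rw [e2, e, ← mul_assoc, ← ENNReal.ofReal_mul (by linarith)]
      congr 2
      have : q - 1 + 1 = q := by ring
      rw [this]; field_simp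
    rw [Finset.sum_congr rfl s1, ← Finset.mul_sum, ← lintegral_finsetSum]
    swap
    · intro I _
      apply Measurable.mul (by fun_prop)
      exact Measurable.ite measurableSet_Iio measurable_const measurable_const
    have s2 : ∫⁻ t in Ioi (0:ℝ), ∑ I ∈ F, ENNReal.ofReal (t ^ (q - 1)) *
          (if t < avg f I then volume (Epart F I) else 0) ≤
        ∫⁻ t in Ioi (0:ℝ), ∫⁻ x in ivSet L, indicator {z : ℝ × ℝ | z.1 / 2 < f z.2}
          (fun z => ENNReal.ofReal (2 * z.1 ^ (q - 2)) * ENNReal.ofReal (f z.2)) (t, x) := by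
      apply setLIntegral_mono' measurableSet_Ioi
      intro t ht
      have ht' : (0:ℝ) < t := ht
      rw [← Finset.mul_sum, ← Finset.sum_filter]
      have hms : MeasurableSet {x | t / 2 < f x} := measurableSet_lt measurable_const hm
      have hw := h.weak hf hm hL hfi ht'
      calc _ ≤ ENNReal.ofReal (t ^ (q - 1)) * (ENNReal.ofReal (2 / t) *
            ∫⁻ x in ivSet L ∩ {x | t / 2 < f x}, ENNReal.ofReal (f x)) := by gcongr
        _ = ENNReal.ofReal (2 * t ^ (q - 2)) *
            ∫⁻ x in ivSet L ∩ {x | t / 2 < f x}, ENNReal.ofReal (f x) := by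
          rw [← mul_assoc, ← ENNReal.ofReal_mul (by positivity)]
          congr 2
          have : q - 1 = (q - 2) + 1 := by ring
          rw [this, Real.rpow_add_one ht'.ne']; field_simp
        _ = _ := by
          rw [← lintegral_const_mul _ (by fun_prop), inter_comm,
            ← Measure.restrict_restrict hms, ← lintegral_indicator hms]
          rfl
    have hmeas : Measurable (indicator {z : ℝ × ℝ | z.1 / 2 < f z.2}
          (fun z => ENNReal.ofReal (2 * z.1 ^ (q - 2)) * ENNReal.ofReal (f z.2))) := by
      apply Measurable.indicator
      · fun_prop
      · exact measurableSet_lt (by fun_prop) (by fun_prop)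
    refine (mul_le_mul_right s2 _).trans ?_
    rw [lintegral_lintegral_swap (by exact hmeas.aemeasurable)]
    rw [← lintegral_const_mul _ (Measurable.lintegral_prod_left' hmeas),
      ← lintegral_const_mul _ (by fun_prop)]
    apply lintegral_mono
    intro x
    have hfx := hf x
    have e := powint (s := q - 2) (A := 2 * f x) (by linarith) (by positivity)
    have e3 : ∫⁻ t in Ioi (0:ℝ), indicator {z : ℝ × ℝ | z.1 / 2 < f z.2}
          (fun z => ENNReal.ofReal (2 * z.1 ^ (q - 2)) * ENNReal.ofReal (f z.2)) (t, x) =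
        (∫⁻ t in Ioo 0 (2 * f x), ENNReal.ofReal (t ^ (q - 2))) * ENNReal.ofReal (2 * f x) := by
      rw [← lintegral_mul_const _ (by fun_prop), ← lintegral_indicator measurableSet_Ioi,
          ← lintegral_indicator measurableSet_Ioo]
      congr 1
      ext t
      simp only [indicator, mem_Ioi, mem_Ioo, Set.mem_ofPred_eq]
      by_cases h0 : 0 < t
      · have hiff : t / 2 < f x ↔ t < 2 * f x := by
          constructor <;> intro <;> linarith
        by_cases h1 : t < 2 * f x
        · simp only [h0, hiff, h1, if_true, and_self]
          rw [← ENNReal.ofReal_mul (by positivity), ← ENNReal.ofReal_mul (by positivity)]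
          congr 1; ring
        · simp [h0, hiff, h1]
      · simp [h0]
    simp only
    have e5 : q - 2 + 1 = q - 1 := by ring
    have hq0 : 0 < q := by linarith
    rw [e5] at e
    rw [e3, e, ← ENNReal.ofReal_mul (by positivity), ← ENNReal.ofReal_mul (by positivity),
      ← ENNReal.ofReal_mul (by positivity)]
    apply ENNReal.ofReal_le_ofReal
    apply le_of_eq
    rcases hfx.eq_or_lt with h0 | h0
    · rw [← h0, Real.zero_rpow (by linarith : q ≠ 0)]; simp
    · rw [Real.mul_rpow (by norm_num) hfx, Real.rpow_sub_one (by norm_num),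
        Real.rpow_sub_one h0.ne']
      field_simp
  have m2 : ENNReal.ofReal ((1 - ε) * ∑ I ∈ F, avg f I ^ q * len I) ≤
      ENNReal.ofReal ((q * 2 ^ q / (q - 1)) * ∫ x in ivSet L, f x ^ q) := by
    rw [ENNReal.ofReal_mul (p := q * 2 ^ q / (q - 1)) (by positivity),
      ofReal_integral_eq_lintegral_ofReal hfq (ae_of_all _ fun x => Real.rpow_nonneg (hf x) _)]
    refine le_trans ?_ main
    rw [Finset.mul_sum, ENNReal.ofReal_sum_of_nonneg]
    · apply Finset.sum_le_sum
      intro I hI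
      have e : (1 - ε) * (avg f I ^ q * len I) = avg f I ^ q * ((1 - ε) * len I) := by ring
      rw [e, ENNReal.ofReal_mul (Real.rpow_nonneg (hA I hI) _)]
      gcongr
      exact h.E_vol hε hε1 hI
    · intro I hI
      have := Real.rpow_nonneg (hA I hI) q
      have := (sub_pos.2 (h.pos I hI)).le
      unfold len
      positivity
  have hint : 0 ≤ ∫ x in ivSet L, f x ^ q := integral_nonneg fun x => Real.rpow_nonneg (hf x) _
  have m3 := (ENNReal.ofReal_le_ofReal_iff (by positivity)).1 m2
  rw [le_div_iff₀ h1ε]; linarith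

/-- integer codes of the members of `Kfam k i`. -/
def Nset (k : ℕ) : ℕ → Set ℤ
  | 0 => {0}
  | (i + 1) => {n' | ∃ n ∈ Nset k i, ∃ j : ℕ, j < 3 ^ (k - 1) ∧ n' = 3 ^ k * n + 3 ^ (k - 1) + j}

/-- triadic cell. -/
def cell (k i : ℕ) (n : ℤ) : ℝ × ℝ := ((n : ℝ) / 3 ^ (k * i), ((n : ℝ) + 1) / 3 ^ (k * i))

/-- code of `I(J)` -/
def gam (k : ℕ) (ch : ℝ × ℝ → Bool) (i : ℕ) (n : ℤ) : ℤ :=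
  if ch (mid (cell k i n)) then 3 ^ k * n + 2 * 3 ^ (k - 1) else 3 ^ k * n + 3 ^ (k - 1) - 1

/-- union of `I(J)`, J in generation `i+1`. -/
def Glev (k : ℕ) (ch : ℝ × ℝ → Bool) (i : ℕ) : Set ℝ :=
  {x | ∃ n ∈ Nset k i, ⌊x * 3 ^ (k * (i + 1))⌋ = gam k ch i n}

/-- the constant `a`. -/
def aa (k : ℕ) : ℝ := (3 : ℝ) ^ k / ((3 : ℝ) ^ (k - 1) + 1)

lemma pow3 {k : ℕ} (hk : 1 ≤ k) : (3 : ℝ) ^ k = 3 * 3 ^ (k - 1) := by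
  obtain ⟨m, rfl⟩ : ∃ m, k = m + 1 := ⟨k - 1, by omega⟩
  simp [pow_succ]; ring

lemma pow3z {k : ℕ} (hk : 1 ≤ k) : (3 : ℤ) ^ k = 3 * 3 ^ (k - 1) := by
  obtain ⟨m, rfl⟩ : ∃ m, k = m + 1 := ⟨k - 1, by omega⟩
  simp [pow_succ]; ring

lemma zp {k : ℕ} : (3 : ℝ) ^ (1 - (k : ℤ)) = 3 / 3 ^ k := by
  rw [zpow_sub₀ (by norm_num)]; simp

lemma pow_step (k i : ℕ) : (3 : ℝ) ^ (k * (i + 1)) = 3 ^ (k * i) * 3 ^ k := by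
  rw [mul_add, pow_add, mul_one]

lemma mid_cell (k i : ℕ) (n : ℤ) : mid (cell k i n) =
    (((n : ℝ) + 1 / 3) / 3 ^ (k * i), ((n : ℝ) + 2 / 3) / 3 ^ (k * i)) := by
  unfold mid cell
  ext <;> simp only <;> ring

lemma len_mid_cell (k i : ℕ) (n : ℤ) : (3 : ℝ) ^ (1 - (k : ℤ)) * len (mid (cell k i n)) =
    1 / 3 ^ (k * (i + 1)) := by
  rw [zp, mid_cell, pow_step]; unfold len; simp only; field_simp; ring

lemma cell_child {k : ℕ} (hk : 1 ≤ k) (i : ℕ) (n : ℤ) (j : ℝ) :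
    (mid (cell k i n)).1 + j * ((3 : ℝ) ^ (1 - (k : ℤ)) * len (mid (cell k i n))) =
      ((3 : ℝ) ^ k * n + 3 ^ (k - 1) + j) / 3 ^ (k * (i + 1)) := by
  rw [len_mid_cell, mid_cell, pow_step, pow3 hk]; simp only; field_simp

lemma Kfam_iff {k : ℕ} (hk : 1 ≤ k) (i : ℕ) (K : ℝ × ℝ) :
    K ∈ Kfam k i ↔ ∃ n ∈ Nset k i, K = cell k i n := by
  induction i generalizing K with
  | zero => simp [Kfam, Nset, cell]
  | succ i ih =>
    constructor
    · rintro ⟨K', hK', j, hj, rfl⟩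
      obtain ⟨n, hn, rfl⟩ := (ih K').1 hK'
      refine ⟨_, ⟨n, hn, j, hj, rfl⟩, ?_⟩
      rw [cell_child hk, cell_child hk]
      unfold cell
      push_cast
      ext <;> simp only; ring
    · rintro ⟨n', ⟨n, hn, j, hj, rfl⟩, rfl⟩
      refine ⟨cell k i n, (ih _).2 ⟨n, hn, rfl⟩, j, hj, ?_⟩
      rw [cell_child hk, cell_child hk]
      unfold cell
      push_cast
      ext <;> simp only; ring

lemma mem_cell (k i : ℕ) (n : ℤ) (x : ℝ) : x ∈ ivSet (cell k i n) ↔ ⌊x * 3 ^ (k * i)⌋ = n := by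
  rw [Int.floor_eq_iff]
  unfold ivSet cell
  simp only [mem_Ico]
  rw [div_le_iff₀ (by positivity), lt_div_iff₀ (by positivity)]

lemma IJ_cell {k : ℕ} (hk : 1 ≤ k) (ch : ℝ × ℝ → Bool) (i : ℕ) (n : ℤ) :
    IJ k ch (mid (cell k i n)) = cell k (i + 1) (gam k ch i n) := by
  unfold IJ gam
  rw [len_mid_cell]
  split_ifs
  · unfold cell
    rw [show mid ((n : ℝ) / 3 ^ (k * i), ((n : ℝ) + 1) / 3 ^ (k * i)) = _ from mid_cell k i n,
      pow_step, pow3 hk, pow3z hk]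
    push_cast
    ext <;> simp only <;> field_simp <;> ring
  · unfold cell
    rw [show mid ((n : ℝ) / 3 ^ (k * i), ((n : ℝ) + 1) / 3 ^ (k * i)) = _ from mid_cell k i n,
      pow_step, pow3 hk, pow3z hk]
    push_cast
    ext <;> simp only <;> field_simp <;> ring

lemma floor_step (k i : ℕ) (x : ℝ) :
    ⌊x * 3 ^ (k * i)⌋ = ⌊x * 3 ^ (k * (i + 1))⌋ / 3 ^ k := by
  have h := Int.floor_div_natCast (x * 3 ^ (k * (i + 1))) (3 ^ k)
  push_cast at h
  rw [← h, pow_step]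
  congr 1
  field_simp

lemma gam_div {k : ℕ} (hk : 1 ≤ k) (ch : ℝ × ℝ → Bool) (i : ℕ) (n : ℤ) :
    gam k ch i n / 3 ^ k = n := by
  have h0 : (0 : ℤ) < 3 ^ (k - 1) := by positivity
  have h3 := pow3z hk
  apply Int.ediv_eq_iff_of_pos (by positivity) |>.2
  unfold gam
  split_ifs <;> constructor <;> nlinarith

lemma Nset_div {k : ℕ} (hk : 1 ≤ k) {i : ℕ} {n : ℤ} (h : n ∈ Nset k (i + 1)) :
    n / 3 ^ k ∈ Nset k i := by
  obtain ⟨m, hm, j, hj, rfl⟩ := h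
  have h0 : (0 : ℤ) < 3 ^ (k - 1) := by positivity
  have h3 := pow3z hk
  have hj' : (j : ℤ) < 3 ^ (k - 1) := by exact_mod_cast hj
  have : (3 ^ k * m + 3 ^ (k - 1) + (j : ℤ)) / 3 ^ k = m := by
    apply Int.ediv_eq_iff_of_pos (by positivity) |>.2
    constructor <;> nlinarith
  rw [this]; exact hm

lemma gam_not_mem {k : ℕ} (hk : 1 ≤ k) (ch : ℝ × ℝ → Bool) (i i' : ℕ) (n : ℤ) :
    gam k ch i n ∉ Nset k (i' + 1) := by
  rintro ⟨m, hm, j, hj, h⟩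
  have h0 : (0 : ℤ) < 3 ^ (k - 1) := by positivity
  have h3 := pow3z hk
  have hj' : (j : ℤ) < 3 ^ (k - 1) := by exact_mod_cast hj
  have hd : (3 ^ k * m + 3 ^ (k - 1) + (j : ℤ)) / 3 ^ k = m := by
    apply Int.ediv_eq_iff_of_pos (by positivity) |>.2
    constructor <;> nlinarith
  have h2 := gam_div hk ch i n
  rw [h, hd] at h2
  subst h2
  unfold gam at h
  split_ifs at h
  · linarith
  · have : (0:ℤ) ≤ j := by positivity
    linarith

lemma Glev_deep {k : ℕ} (hk : 1 ≤ k) {ch : ℝ × ℝ → Bool} {i : ℕ} {x : ℝ} (hx : x ∈ Glev k ch i)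
    {i' : ℕ} (h : i' ≤ i) : ⌊x * 3 ^ (k * i')⌋ ∈ Nset k i' := by
  obtain ⟨n, hn, e⟩ := hx
  have h0 : ⌊x * 3 ^ (k * i)⌋ ∈ Nset k i := by rw [floor_step, e, gam_div hk]; exact hn
  induction h using Nat.decreasingInduction with
  | self => exact h0
  | of_succ m hm ih => rw [floor_step]; exact Nset_div hk ih

lemma Glev_disj {k : ℕ} (hk : 1 ≤ k) {ch : ℝ × ℝ → Bool} {i i' : ℕ} {x : ℝ}
    (hx : x ∈ Glev k ch i) (hx' : x ∈ Glev k ch i') : i = i' := by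
  have aux : ∀ i i', x ∈ Glev k ch i → x ∈ Glev k ch i' → ¬ i < i' := by
    intro i i' hx hx' hlt
    have h1 := Glev_deep hk hx' (show i + 1 ≤ i' from hlt)
    obtain ⟨n, hn, e⟩ := hx
    rw [e] at h1
    exact gam_not_mem hk ch i i n h1
  rcases lt_trichotomy i i' with h | h | h
  · exact absurd h (aux i i' hx hx')
  · exact h
  · exact absurd h (aux i' i hx' hx)

lemma Glev_unit {k : ℕ} (hk : 1 ≤ k) {ch : ℝ × ℝ → Bool} {i : ℕ} {x : ℝ}
    (hx : x ∈ Glev k ch i) : 0 ≤ x ∧ x < 1 := by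
  have h := Glev_deep hk hx (Nat.zero_le i)
  simp only [Nset, mul_zero, pow_zero, mul_one, mem_singleton_iff] at h
  rw [Int.floor_eq_iff] at h
  simpa using h

/-- position within a cell: away from the boundary -/
lemma Glev_frac {k : ℕ} (hk : 4 ≤ k) {ch : ℝ × ℝ → Bool} {i : ℕ} {x : ℝ} (hx : x ∈ Glev k ch i)
    {i' : ℕ} (h : i' ≤ i) : (⌊x * 3 ^ (k * i')⌋ : ℝ) + 1 / 4 ≤ x * 3 ^ (k * i') ∧
      x * 3 ^ (k * i') ≤ ⌊x * 3 ^ (k * i')⌋ + 3 / 4 := by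
  have hk1 : 1 ≤ k := by omega
  set N := ⌊x * 3 ^ (k * i')⌋ with hN
  set D := ⌊x * 3 ^ (k * (i' + 1))⌋ with hD
  have hdig : 3 ^ k * N + 3 ^ (k - 1) - 1 ≤ D ∧ D ≤ 3 ^ k * N + 2 * 3 ^ (k - 1) := by
    have h0 : (0 : ℤ) < 3 ^ (k - 1) := by positivity
    have hfs : N = D / 3 ^ k := floor_step k i' x
    rcases h.eq_or_lt with h | h
    · subst h
      obtain ⟨n, hn, e⟩ := hx
      rw [← hD] at e
      have : N = n := by rw [hfs, e, gam_div hk1]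
      rw [this, e]
      unfold gam
      split_ifs <;> constructor <;> linarith
    · have h1 : D ∈ Nset k (i' + 1) := Glev_deep hk1 hx (show i' + 1 ≤ i from h)
      obtain ⟨m, hm, j, hj, e⟩ := h1
      have h3 := pow3z hk1
      have hj' : (j : ℤ) < 3 ^ (k - 1) := by exact_mod_cast hj
      have hd : (3 ^ k * m + 3 ^ (k - 1) + (j : ℤ)) / 3 ^ k = m := by
        apply Int.ediv_eq_iff_of_pos (by positivity) |>.2
        constructor <;> nlinarith
      have : N = m := by rw [hfs, e, hd]
      rw [this, e]
      have : (0:ℤ) ≤ j := by positivity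
      constructor <;> linarith
  have hf1 : (D : ℝ) ≤ x * 3 ^ (k * (i' + 1)) := Int.floor_le _
  have hf2 : x * 3 ^ (k * (i' + 1)) < D + 1 := Int.lt_floor_add_one _
  have hd1 : (3 : ℝ) ^ k * N + 3 ^ (k - 1) - 1 ≤ D := by exact_mod_cast hdig.1
  have hd2 : (D : ℝ) ≤ 3 ^ k * N + 2 * 3 ^ (k - 1) := by exact_mod_cast hdig.2
  rw [pow_step] at hf1 hf2
  have h27 : (27 : ℝ) ≤ 3 ^ (k - 1) := by
    calc (27 : ℝ) = 3 ^ 3 := by norm_num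
      _ ≤ _ := pow_le_pow_right₀ (by norm_num) (by omega)
  have h3 := pow3 hk1
  have hpos : (0 : ℝ) < 3 ^ k := by positivity
  constructor
  · by_contra hc
    push Not at hc
    have := mul_lt_mul_of_pos_right hc hpos
    nlinarith
  · by_contra hc
    push Not at hc
    have := mul_lt_mul_of_pos_right hc hpos
    nlinarith

lemma Glev_sep_aux {k : ℕ} (hk : 4 ≤ k) {ch : ℝ × ℝ → Bool} {i i' : ℕ} {x y : ℝ}
    (hx : x ∈ Glev k ch i) (hy : y ∈ Glev k ch i') (h : i < i') :
    1 / 3 ^ (k * (i + 1)) / 4 ≤ |x - y| := by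
  have hk1 : 1 ≤ k := by omega
  have h1 := Glev_deep hk1 hy (show i + 1 ≤ i' from h)
  have h2 := Glev_frac hk hy (show i + 1 ≤ i' from h)
  have hne : ⌊x * 3 ^ (k * (i + 1))⌋ ≠ ⌊y * 3 ^ (k * (i + 1))⌋ := by
    obtain ⟨n, hn, e⟩ := hx
    rw [e]; intro he; rw [← he] at h1
    exact gam_not_mem hk1 ch i i n h1
  set P : ℝ := 3 ^ (k * (i + 1)) with hP
  have hPpos : 0 < P := by positivity
  have hfx1 : (⌊x * P⌋ : ℝ) ≤ x * P := Int.floor_le _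
  have hfx2 : x * P < ⌊x * P⌋ + 1 := Int.lt_floor_add_one _
  rw [div_div, div_le_iff₀ (by positivity)]
  rcases lt_or_gt_of_ne hne with hl | hl
  · have : (⌊x * P⌋ : ℝ) + 1 ≤ ⌊y * P⌋ := by exact_mod_cast hl
    have h5 : 1 / 4 ≤ (y - x) * P := by linarith [h2.1]
    have h6 : y - x ≤ |x - y| := by rw [abs_sub_comm]; exact le_abs_self _
    nlinarith
  · have : (⌊y * P⌋ : ℝ) + 1 ≤ ⌊x * P⌋ := by exact_mod_cast hl
    have h5 : 1 / 4 ≤ (x - y) * P := by linarith [h2.2]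
    have h6 : x - y ≤ |x - y| := le_abs_self _
    nlinarith

lemma Glev_sep {k : ℕ} (hk : 4 ≤ k) {ch : ℝ × ℝ → Bool} {i i' : ℕ} {x y : ℝ}
    (hx : x ∈ Glev k ch i) (hy : y ∈ Glev k ch i')
    (hxy : |x - y| < 1 / 3 ^ (k * (i + 1)) / 4) : i = i' := by
  rcases lt_trichotomy i i' with h | h | h
  · exact absurd (Glev_sep_aux hk hx hy h) (not_le.2 hxy)
  · exact h
  · have h1 := Glev_sep_aux hk hy hx h
    rw [abs_sub_comm] at h1
    have : (1:ℝ) / 3 ^ (k * (i + 1)) / 4 ≤ 1 / 3 ^ (k * (i' + 1)) / 4 := by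
      gcongr
      norm_num
    linarith

lemma meas_Glev (k : ℕ) (ch : ℝ × ℝ → Bool) (i : ℕ) : MeasurableSet (Glev k ch i) := by
  have : Glev k ch i = Set.preimage (fun x : ℝ => ⌊x * 3 ^ (k * (i + 1))⌋) (Set.image (gam k ch i) (Nset k i)) := by
    ext x; simp [Glev, eq_comm]
  rw [this]
  exact (Int.measurable_floor.comp (by fun_prop)) (MeasurableSet.of_discrete)

lemma wgt_eq {k : ℕ} (hk : 1 ≤ k) (ch : ℝ × ℝ → Bool) (x : ℝ) :
    wgt k ch x = ∑' i : ℕ, indicator (Glev k ch i) (fun _ => aa k ^ (i + 1)) x := by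
  unfold wgt
  congr 1
  ext i
  change ∑' J : ↥(Jfam k (i + 1)), Set.indicator (ivSet (IJ k ch (J : ℝ × ℝ)))
      (fun _ => aa k ^ (i + 1)) x = _
  have hJ : ∀ J : ↥(Jfam k (i + 1)), ∃ n ∈ Nset k i, (J : ℝ × ℝ) = mid (cell k i n) := by
    rintro ⟨J, K, hK, rfl⟩
    obtain ⟨n, hn, rfl⟩ := (Kfam_iff hk i K).1 hK
    exact ⟨n, hn, rfl⟩
  by_cases hx : x ∈ Glev k ch i
  · rw [indicator_of_mem hx]
    obtain ⟨n, hn, e⟩ := hx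
    have hmem : mid (cell k i n) ∈ Jfam k (i + 1) :=
      ⟨cell k i n, (Kfam_iff hk i _).2 ⟨n, hn, rfl⟩, rfl⟩
    rw [tsum_eq_single (⟨mid (cell k i n), hmem⟩ : ↥(Jfam k (i + 1)))]
    · rw [indicator_of_mem]
      rw [IJ_cell hk, mem_cell]; exact e
    · intro J hne
      apply indicator_of_notMem
      obtain ⟨m, hm, e'⟩ := hJ J
      rw [e', IJ_cell hk, mem_cell, e]
      intro he
      apply hne
      apply Subtype.ext
      rw [e']
      have := gam_div hk ch i n
      rw [he, gam_div hk] at this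
      rw [this]
  · rw [indicator_of_notMem hx]
    have : ∀ J : ↥(Jfam k (i + 1)), Set.indicator (ivSet (IJ k ch (J : ℝ × ℝ)))
      (fun _ => aa k ^ (i + 1)) x = 0 := by
      intro J
      apply indicator_of_notMem
      obtain ⟨m, hm, e'⟩ := hJ J
      rw [e', IJ_cell hk, mem_cell]
      intro he
      exact hx ⟨m, hm, he⟩
    simp [this]

lemma wgt_mem {k : ℕ} (hk : 1 ≤ k) {ch : ℝ × ℝ → Bool} {x : ℝ} {i : ℕ} (hx : x ∈ Glev k ch i) :
    wgt k ch x = aa k ^ (i + 1) := by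
  rw [wgt_eq hk, tsum_eq_single i, indicator_of_mem hx]
  intro i' hne
  apply indicator_of_notMem
  intro h
  exact hne (Glev_disj hk h hx)

lemma wgt_not_mem {k : ℕ} (hk : 1 ≤ k) {ch : ℝ × ℝ → Bool} {x : ℝ} (hx : ∀ i, x ∉ Glev k ch i) :
    wgt k ch x = 0 := by
  rw [wgt_eq hk]
  simp [hx]

lemma aa_ge {k : ℕ} (hk : 4 ≤ k) : 2 ≤ aa k := by
  have h27 : (27 : ℝ) ≤ 3 ^ (k - 1) := by
    calc (27 : ℝ) = 3 ^ 3 := by norm_num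
      _ ≤ _ := pow_le_pow_right₀ (by norm_num) (by omega)
  unfold aa
  rw [le_div_iff₀ (by positivity)]
  linarith [pow3 (show 1 ≤ k by omega)]

lemma wgt_nonneg {k : ℕ} (hk : 4 ≤ k) (ch : ℝ × ℝ → Bool) (x : ℝ) : 0 ≤ wgt k ch x := by
  have := aa_ge hk
  rw [wgt_eq (by omega)]
  exact tsum_nonneg fun i => indicator_nonneg (fun _ _ => by positivity) _

lemma wgt_ofReal {k : ℕ} (hk : 4 ≤ k) (ch : ℝ × ℝ → Bool) (x : ℝ) :
    ENNReal.ofReal (wgt k ch x) =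
      ∑' i : ℕ, indicator (Glev k ch i) (fun _ => ENNReal.ofReal (aa k ^ (i + 1))) x := by
  by_cases h : ∃ i, x ∈ Glev k ch i
  · obtain ⟨i, hi⟩ := h
    rw [wgt_mem (by omega) hi, tsum_eq_single i, indicator_of_mem hi]
    intro i' hne
    apply indicator_of_notMem
    intro h
    exact hne (Glev_disj (by omega) h hi)
  · push Not at h
    rw [wgt_not_mem (by omega) h]
    simp [h]

lemma meas_wgt {k : ℕ} (hk : 4 ≤ k) (ch : ℝ × ℝ → Bool) : Measurable (wgt k ch) := by
  have h1 : Measurable (fun x => ENNReal.ofReal (wgt k ch x)) := by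
    simp only [wgt_ofReal hk]
    exact Measurable.tsum fun i => measurable_const.indicator (meas_Glev k ch i)
  have h2 : wgt k ch = fun x => (ENNReal.ofReal (wgt k ch x)).toReal := by
    ext x; rw [ENNReal.toReal_ofReal (wgt_nonneg hk ch x)]
  rw [h2]
  exact h1.ennreal_toReal

/-- codes of the descendants of the cell with code `q`. -/
def Dset (k : ℕ) (q : ℤ) : ℕ → Finset ℤ
  | 0 => {q}
  | (d + 1) => (Dset k q d ×ˢ Finset.range (3 ^ (k - 1))).image
      (fun z => 3 ^ k * z.1 + 3 ^ (k - 1) + (z.2 : ℤ))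

lemma Dset_card (k : ℕ) (q : ℤ) (d : ℕ) : (Dset k q d).card ≤ (3 ^ (k - 1)) ^ d := by
  induction d with
  | zero => simp [Dset]
  | succ d ih =>
    refine Finset.card_image_le.trans ?_
    rw [Finset.card_product, Finset.card_range, pow_succ]
    exact Nat.mul_le_mul_right _ ih

lemma Dset_mem {k : ℕ} (hk : 1 ≤ k) (q : ℤ) (m d : ℕ) (x : ℝ) (hq : ⌊x * 3 ^ (k * m)⌋ = q)
    (h : ⌊x * 3 ^ (k * (m + d))⌋ ∈ Nset k (m + d)) : ⌊x * 3 ^ (k * (m + d))⌋ ∈ Dset k q d := by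
  induction d with
  | zero => simp [Dset, hq]
  | succ d ih =>
    have h1 := Nset_div hk h
    have h2 := floor_step k (m + d) x
    rw [show m + (d + 1) = m + d + 1 by ring] at *
    rw [← h2] at h1
    have h3 := ih h1
    obtain ⟨n, hn, j, hj, e⟩ := h
    have h0 : (0 : ℤ) < 3 ^ (k - 1) := by positivity
    have h33 := pow3z hk
    have hj' : (j : ℤ) < 3 ^ (k - 1) := by exact_mod_cast hj
    have h4 : (3 ^ k * n + 3 ^ (k - 1) + (j : ℤ)) / 3 ^ k = n := by
      apply Int.ediv_eq_iff_of_pos (by positivity) |>.2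
      constructor <;> nlinarith
    rw [e, h4] at h2
    rw [h2] at h3
    rw [e]
    simp only [Dset, Finset.mem_image, Finset.mem_product, Finset.mem_range]
    exact ⟨(n, j), ⟨h3, hj⟩, rfl⟩

lemma vol_cell (k i : ℕ) (n : ℤ) : volume (ivSet (cell k i n)) = ENNReal.ofReal (1 / 3 ^ (k * i)) := by
  unfold ivSet cell
  rw [Real.volume_Ico]
  congr 1
  ring

lemma vol_Glev_cell {k : ℕ} (hk : 1 ≤ k) (ch : ℝ × ℝ → Bool) (m d : ℕ) (q : ℤ) :
    volume (Glev k ch (m + d) ∩ ivSet (cell k m q)) ≤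
      ENNReal.ofReal ((3 ^ (k - 1)) ^ d * (1 / 3 ^ (k * (m + d + 1)))) := by
  have hsub : Glev k ch (m + d) ∩ ivSet (cell k m q) ⊆
      ⋃ n ∈ Dset k q d, ivSet (cell k (m + d + 1) (gam k ch (m + d) n)) := by
    rintro x ⟨hx, hq⟩
    rw [mem_cell] at hq
    have h1 := Glev_deep hk hx le_rfl
    have h2 := Dset_mem hk q m d x hq h1
    obtain ⟨n, hn, e⟩ := hx
    have h3 : ⌊x * 3 ^ (k * (m + d))⌋ = n := by rw [floor_step, e, gam_div hk]
    rw [h3] at h2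
    simp only [mem_iUnion]
    exact ⟨n, h2, (mem_cell _ _ _ _).2 e⟩
  refine (measure_mono hsub).trans ((measure_biUnion_finset_le _ _).trans ?_)
  simp only [vol_cell, Finset.sum_const, nsmul_eq_mul]
  rw [ENNReal.ofReal_mul (by positivity)]
  gcongr
  rw [show ((3 : ℝ) ^ (k - 1)) ^ d = (((3 ^ (k - 1)) ^ d : ℕ) : ℝ) by push_cast; rfl,
    ENNReal.ofReal_natCast]
  exact_mod_cast Dset_card k q d

lemma wgt_cell {k : ℕ} (hk : 4 ≤ k) (ch : ℝ × ℝ → Bool) (m : ℕ) (q : ℤ) :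
    ∫⁻ x in ivSet (cell k m q), ENNReal.ofReal (wgt k ch x) ≤
      ENNReal.ofReal (2 * aa k ^ m / 3 ^ (k * m)) := by
  have ha := aa_ge hk
  have hpt : ∀ x, ENNReal.ofReal (wgt k ch x) ≤ ENNReal.ofReal (aa k ^ m) +
      ∑' d : ℕ, indicator (Glev k ch (m + d)) (fun _ => ENNReal.ofReal (aa k ^ (m + d + 1))) x := by
    intro x
    by_cases h : ∃ i, x ∈ Glev k ch i
    · obtain ⟨i, hi⟩ := h
      rw [wgt_mem (by omega) hi]
      rcases lt_or_ge i m with h | h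
      · refine le_trans ?_ le_self_add
        exact ENNReal.ofReal_le_ofReal (pow_le_pow_right₀ (by linarith) h)
      · obtain ⟨d, rfl⟩ := Nat.exists_eq_add_of_le h
        refine le_trans ?_ le_add_self
        refine le_trans ?_ (ENNReal.le_tsum d)
        rw [indicator_of_mem hi]
    · push Not at h
      rw [wgt_not_mem (by omega) h]
      simp
  have hE : (0 : ℝ) < 3 ^ (k - 1) := by positivity
  have h3 := pow3 (show 1 ≤ k by omega)
  have haa : aa k = 3 * 3 ^ (k - 1) / (3 ^ (k - 1) + 1) := by
    unfold aa; rw [h3]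
  have hgeo : HasSum (fun d : ℕ => aa k ^ (m + d + 1) * ((3 ^ (k - 1)) ^ d * (1 / 3 ^ (k * (m + d + 1)))))
      (aa k ^ m / 3 ^ (k * m)) := by
    have hg := hasSum_geometric_of_lt_one (r := aa k / 3) (by positivity) (by
      rw [haa, div_div, div_lt_one (by positivity)]; nlinarith)
    have hg2 := hg.mul_left (aa k ^ m / 3 ^ (k * m) * (aa k / 3 ^ k))
    have e1 : aa k ^ m / 3 ^ (k * m) * (aa k / 3 ^ k) * (1 - aa k / 3)⁻¹ = aa k ^ m / 3 ^ (k * m) := by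
      have : aa k / 3 ^ k * (1 - aa k / 3)⁻¹ = 1 := by
        have h1 : 1 - aa k / 3 = 1 / (3 ^ (k - 1) + 1) := by rw [haa]; field_simp; ring
        rw [h1, haa, h3]; field_simp
      rw [mul_assoc, this, mul_one]
    rw [e1] at hg2
    refine (congrArg (fun f => HasSum f _) (funext fun d => ?_)).mpr hg2
    have e2 : (3 : ℝ) ^ (k * (m + d + 1)) = 3 ^ (k * m) * (3 ^ k) ^ d * 3 ^ k := by
      rw [← pow_mul, ← pow_add, ← pow_add]; congr 1; ring
    rw [e2, div_pow, h3, mul_pow, pow_succ, pow_add]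
    field_simp
  calc ∫⁻ x in ivSet (cell k m q), ENNReal.ofReal (wgt k ch x)
      ≤ ∫⁻ x in ivSet (cell k m q), (ENNReal.ofReal (aa k ^ m) +
      ∑' d : ℕ, indicator (Glev k ch (m + d)) (fun _ => ENNReal.ofReal (aa k ^ (m + d + 1))) x) :=
        lintegral_mono fun x => hpt x
    _ = ENNReal.ofReal (aa k ^ m) * ENNReal.ofReal (1 / 3 ^ (k * m)) +
        ∑' d : ℕ, ENNReal.ofReal (aa k ^ (m + d + 1)) *
          volume (Glev k ch (m + d) ∩ ivSet (cell k m q)) := by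
        rw [lintegral_add_left measurable_const, lintegral_tsum
          (fun d => (measurable_const.indicator (meas_Glev k ch _)).aemeasurable)]
        congr 1
        · simp [vol_cell]
        · congr 1; ext d
          rw [lintegral_indicator_const (meas_Glev k ch _), Measure.restrict_apply (meas_Glev k ch _)]
    _ ≤ ENNReal.ofReal (aa k ^ m / 3 ^ (k * m)) + ENNReal.ofReal (aa k ^ m / 3 ^ (k * m)) := by
        gcongr
        · rw [← ENNReal.ofReal_mul (by positivity)]; apply le_of_eq; congr 1; ring
        · rw [← hgeo.tsum_eq, ENNReal.ofReal_tsum_of_nonneg (fun d => by positivity) hgeo.summable]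
          apply ENNReal.tsum_le_tsum
          intro d
          rw [ENNReal.ofReal_mul (by positivity)]
          gcongr
          exact vol_Glev_cell (by omega) ch m d q
    _ = _ := by
        rw [← ENNReal.ofReal_add (by positivity) (by positivity)]; congr 1; ring

lemma wgt_iv {k : ℕ} (hk : 4 ≤ k) (ch : ℝ × ℝ → Bool) (m : ℕ) (I : ℝ × ℝ)
    (hI : 1 / 3 ^ (k * m) / 4 ≤ len I) :
    ∫⁻ x in ivSet I, ENNReal.ofReal (wgt k ch x) ≤ ENNReal.ofReal (18 * aa k ^ m * len I) := by
  have ha := aa_ge hk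
  set T : ℝ := 3 ^ (k * m) with hT
  have hT0 : 0 < T := by positivity
  have hl : 1 / 4 ≤ len I * T := by
    rw [div_right_comm, div_le_iff₀ hT0] at hI; exact hI
  have hl0 : 0 < len I := by
    by_contra h; push Not at h; nlinarith
  set Q := Finset.Icc ⌊I.1 * T⌋ ⌊I.2 * T⌋
  have hsub : ivSet I ⊆ ⋃ q ∈ Q, ivSet (cell k m q) := by
    intro x hx
    simp only [mem_iUnion]
    refine ⟨⌊x * T⌋, ?_, (mem_cell _ _ _ _).2 rfl⟩
    rw [Finset.mem_Icc]
    exact ⟨Int.floor_le_floor (by have := hx.1; gcongr),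
      Int.floor_le_floor (by have := hx.2.le; gcongr)⟩
  have hcard : (Q.card : ℝ) ≤ 9 * (len I * T) := by
    have hle : ⌊I.1 * T⌋ ≤ ⌊I.2 * T⌋ + 1 := by
      have : ⌊I.1 * T⌋ ≤ ⌊I.2 * T⌋ := Int.floor_le_floor (by unfold len at hl0; nlinarith)
      omega
    have : ((Q.card : ℤ) : ℝ) = ((⌊I.2 * T⌋ + 1 - ⌊I.1 * T⌋ : ℤ) : ℝ) := by
      congr 1
      exact Int.card_Icc_of_le _ _ hle
    push_cast at this
    rw [this]
    have h1 := Int.floor_le (I.2 * T)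
    have h2 := Int.lt_floor_add_one (I.1 * T)
    unfold len at *
    nlinarith
  calc ∫⁻ x in ivSet I, ENNReal.ofReal (wgt k ch x)
      ≤ ∫⁻ x in ⋃ q ∈ Q, ivSet (cell k m q), ENNReal.ofReal (wgt k ch x) := lintegral_mono_set hsub
    _ ≤ ∑ q ∈ Q, ∫⁻ x in ivSet (cell k m q), ENNReal.ofReal (wgt k ch x) :=
        (lintegral_biUnion_finset (fun a _ b _ hab => Set.disjoint_left.2 fun x hx hx' =>
          hab (by rw [mem_cell] at hx hx'; rw [← hx, ← hx']))
          (fun q _ => by unfold ivSet; exact measurableSet_Ico) _).le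
    _ ≤ ∑ q ∈ Q, ENNReal.ofReal (2 * aa k ^ m / T) := Finset.sum_le_sum fun q _ => wgt_cell hk ch m q
    _ = ENNReal.ofReal (Q.card * (2 * aa k ^ m / T)) := by
        rw [Finset.sum_const, nsmul_eq_mul, ENNReal.ofReal_mul (by positivity), ENNReal.ofReal_natCast]
    _ ≤ _ := by
        apply ENNReal.ofReal_le_ofReal
        calc (Q.card : ℝ) * (2 * aa k ^ m / T) ≤ 9 * (len I * T) * (2 * aa k ^ m / T) := by gcongr
          _ = _ := by field_simp; ring

lemma wgt_total {k : ℕ} (hk : 4 ≤ k) (ch : ℝ × ℝ → Bool) :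
    ∫⁻ x, ENNReal.ofReal (wgt k ch x) ≤ ENNReal.ofReal 2 := by
  have h := wgt_cell hk ch 0 0
  have e : ∫⁻ x, ENNReal.ofReal (wgt k ch x) =
      ∫⁻ x in ivSet (cell k 0 0), ENNReal.ofReal (wgt k ch x) := by
    rw [← lintegral_indicator (by unfold ivSet; exact measurableSet_Ico)]
    congr 1; ext x
    by_cases hx : x ∈ ivSet (cell k 0 0)
    · rw [indicator_of_mem hx]
    · rw [indicator_of_notMem hx, wgt_not_mem (by omega)]
      · simp
      · intro i hi
        have := Glev_unit (by omega) hi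
        apply hx
        simpa [ivSet, cell] using this
  rw [e]
  simpa using h

section

/-- `x` lies in the support, in block `k`, generation `i+1`. -/
def At (ch : ℕ → ℝ × ℝ → Bool) (x : ℝ) (k i : ℕ) : Prop :=
  4000 ≤ k ∧ x - 9 ^ k ∈ Glev k (ch k) i

variable {ch : ℕ → ℝ × ℝ → Bool} {x y p r : ℝ} {k i k' i' : ℕ}

lemma At.unit (h : At ch x k i) : (9 : ℝ) ^ k ≤ x ∧ x < 9 ^ k + 1 := by
  have h4 := h.1
  have := Glev_unit (by omega) h.2
  constructor <;> linarith

lemma nine_big (hk : 4000 ≤ k) : (81 : ℝ) ≤ 9 ^ k := by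
  calc (81 : ℝ) = 9 ^ 2 := by norm_num
    _ ≤ _ := pow_le_pow_right₀ (by norm_num) (by omega)

lemma nine_lt (h : k < k') : (9 : ℝ) * 9 ^ k ≤ 9 ^ k' := by
  calc (9 : ℝ) * 9 ^ k = 9 ^ (k + 1) := by ring
    _ ≤ _ := pow_le_pow_right₀ (by norm_num) h

lemma At.near (hx : At ch x k i) (hy : At ch y k' i') (h : |x - y| < 9 ^ k / 4) : k = k' := by
  have h1 := hx.unit
  have h2 := hy.unit
  have h3 := nine_big hx.1
  have h4 := nine_big hy.1
  rw [abs_lt] at h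
  rcases lt_trichotomy k k' with hl | hl | hl
  · have := nine_lt hl; exfalso; linarith
  · exact hl
  · have := nine_lt hl; exfalso; linarith

lemma At.uniq (hx : At ch x k i) (hy : At ch x k' i') : k = k' ∧ i = i' := by
  have h3 := nine_big hx.1
  have := hx.near hy (by simp)
  subst this
  have h4 := hx.1
  exact ⟨rfl, Glev_disj (by omega) hx.2 hy.2⟩

lemma not_at_block (hx : At ch x k i) (hk' : 4000 ≤ k') (hne : k' ≠ k) :
    wgt k' (ch k') (x - 9 ^ k') = 0 := by
  apply wgt_not_mem (by omega)
  intro i' hi'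
  exact hne ((hx.uniq (show At ch x k' i' from ⟨hk', hi'⟩)).1.symm)

lemma w_at (r : ℝ) (h : At ch x k i) : wGlob r ch x = (k : ℝ) ^ (-r) * aa k ^ (i + 1) := by
  have h4 := h.1
  obtain ⟨j, rfl⟩ : ∃ j, k = j + 4000 := ⟨k - 4000, by omega⟩
  unfold wGlob
  rw [tsum_eq_single j, wgt_mem (by omega) h.2]
  intro j' hj'
  rw [not_at_block h (by omega) (by omega), mul_zero]

lemma aa_pos (hk : 4000 ≤ k) : 2 ≤ aa k := aa_ge (by omega)

lemma s_at (p : ℝ) (h : At ch x k i) : sGlob p ch x = (aa k ^ (i + 1)) ^ (1 - p) := by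
  have h4 := h.1
  have := aa_pos h4
  obtain ⟨j, rfl⟩ : ∃ j, k = j + 4000 := ⟨k - 4000, by omega⟩
  unfold sGlob sgm
  rw [tsum_eq_single j, wgt_mem (by omega) h.2, if_pos (by positivity)]
  intro j' hj'
  rw [not_at_block h (by omega) (by omega)]; simp

lemma w_not (r : ℝ) (h : ∀ k i, ¬ At ch x k i) : wGlob r ch x = 0 := by
  unfold wGlob
  convert tsum_zero with j
  rw [wgt_not_mem (by omega), mul_zero]
  intro i hi
  exact h _ i ⟨by omega, hi⟩

lemma s_not (p : ℝ) (h : ∀ k i, ¬ At ch x k i) : sGlob p ch x = 0 := by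
  unfold sGlob sgm
  convert tsum_zero with j
  rw [wgt_not_mem (by omega)]
  · simp
  intro i hi
  exact h _ i ⟨by omega, hi⟩

lemma w_nonneg (r : ℝ) (ch : ℕ → ℝ × ℝ → Bool) (x : ℝ) : 0 ≤ wGlob r ch x :=
  tsum_nonneg fun j => mul_nonneg (by positivity) (wgt_nonneg (by omega) _ _)

lemma s_nonneg (p : ℝ) (ch : ℕ → ℝ × ℝ → Bool) (x : ℝ) : 0 ≤ sGlob p ch x := by
  refine tsum_nonneg fun j => ?_
  unfold sgm
  split_ifs
  · positivity
  · exact le_rfl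

lemma s_le_one (hp : 1 < p) (ch : ℕ → ℝ × ℝ → Bool) (x : ℝ) : sGlob p ch x ≤ 1 := by
  by_cases h : ∃ k i, At ch x k i
  · obtain ⟨k, i, h⟩ := h
    rw [s_at p h]
    have := aa_pos h.1
    exact Real.rpow_le_one_of_one_le_of_nonpos (one_le_pow₀ (by linarith)) (by linarith)
  · push Not at h
    rw [s_not p h]; norm_num

lemma meas_w (r : ℝ) (ch : ℕ → ℝ × ℝ → Bool) : Measurable (wGlob r ch) := by
  unfold wGlob
  refine Measurable.tsum fun j => ?_
  exact ((meas_wgt (by omega) _).comp (by fun_prop)).const_mul _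

lemma meas_s (p : ℝ) (ch : ℕ → ℝ × ℝ → Bool) : Measurable (sGlob p ch) := by
  unfold sGlob
  refine Measurable.tsum fun j => ?_
  have h : Measurable (fun x : ℝ => wgt (j + 4000) (ch (j + 4000)) (x - 9 ^ (j + 4000))) :=
    (meas_wgt (by omega) _).comp (by fun_prop)
  unfold sgm
  exact Measurable.ite (measurableSet_lt measurable_const h) (h.pow_const _) measurable_const

lemma int_s (hp : 1 < p) (ch : ℕ → ℝ × ℝ → Bool) (I : ℝ × ℝ) :
    IntegrableOn (sGlob p ch) (ivSet I) := by
  unfold ivSet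
  refine Measure.integrableOn_of_bounded (M := 1) (by simp) (meas_s p ch).aestronglyMeasurable ?_
  refine Eventually.of_forall fun x => ?_
  rw [Real.norm_eq_abs, abs_of_nonneg (s_nonneg p ch x)]
  exact s_le_one hp ch x

/-- total mass bound. -/
def Ctot (r : ℝ) : ℝ := ∑' j : ℕ, ((j + 4000 : ℕ) : ℝ) ^ (-r) * 2

lemma Ctot_summ (hr : 1 < r) : Summable (fun j : ℕ => ((j + 4000 : ℕ) : ℝ) ^ (-r) * 2) := by
  apply Summable.mul_right
  exact (summable_nat_add_iff (f := fun n : ℕ => (n : ℝ) ^ (-r)) 4000).2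
    (Real.summable_nat_rpow.2 (by linarith))

lemma Ctot_nonneg (r : ℝ) : 0 ≤ Ctot r := tsum_nonneg fun j => by positivity

lemma w_le_tsum (r : ℝ) (ch : ℕ → ℝ × ℝ → Bool) (x : ℝ) : ENNReal.ofReal (wGlob r ch x) ≤
    ∑' j : ℕ, ENNReal.ofReal (((j + 4000 : ℕ) : ℝ) ^ (-r)) *
      ENNReal.ofReal (wgt (j + 4000) (ch (j + 4000)) (x - (9 : ℝ) ^ (j + 4000))) := by
  by_cases h : ∃ k i, At ch x k i
  · obtain ⟨k, i, h⟩ := h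
    have h4 := h.1
    rw [w_at r h]
    obtain ⟨j, rfl⟩ : ∃ j, k = j + 4000 := ⟨k - 4000, by omega⟩
    refine le_trans ?_ (ENNReal.le_tsum j)
    rw [wgt_mem (by omega) h.2, ENNReal.ofReal_mul (by positivity)]
  · push Not at h
    rw [w_not r h]; simp

lemma w_total (hr : 1 < r) (ch : ℕ → ℝ × ℝ → Bool) :
    ∫⁻ x, ENNReal.ofReal (wGlob r ch x) ≤ ENNReal.ofReal (Ctot r) := by
  refine (lintegral_mono (w_le_tsum r ch)).trans ?_
  have hm : ∀ j : ℕ, Measurable (fun x : ℝ => ENNReal.ofReal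
      (wgt (j + 4000) (ch (j + 4000)) (x - (9 : ℝ) ^ (j + 4000)))) := fun j =>
    ((meas_wgt (by omega) _).comp (by fun_prop)).ennreal_ofReal
  rw [lintegral_tsum (fun j => ((hm j).const_mul _).aemeasurable)]
  unfold Ctot
  rw [ENNReal.ofReal_tsum_of_nonneg (fun j => by positivity) (Ctot_summ hr)]
  apply ENNReal.tsum_le_tsum
  intro j
  rw [lintegral_const_mul _ (hm j), ENNReal.ofReal_mul (by positivity)]
  gcongr
  rw [lintegral_sub_right_eq_self (fun x => ENNReal.ofReal (wgt (j + 4000) (ch (j + 4000)) x))]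
  exact wgt_total (by omega) _

lemma integ_w (hr : 1 < r) (ch : ℕ → ℝ × ℝ → Bool) : Integrable (wGlob r ch) := by
  refine ⟨(meas_w r ch).aestronglyMeasurable, ?_⟩
  rw [hasFiniteIntegral_iff_ofReal (Eventually.of_forall (w_nonneg r ch))]
  exact (w_total hr ch).trans_lt ENNReal.ofReal_lt_top

lemma int_w (hr : 1 < r) (ch : ℕ → ℝ × ℝ → Bool) (I : ℝ × ℝ) :
    IntegrableOn (wGlob r ch) (ivSet I) := (integ_w hr ch).integrableOn

lemma mass_le_of_lint {u : ℝ → ℝ} (hm : Measurable u) (hu : ∀ x, 0 ≤ u x) {I : ℝ × ℝ} {B : ℝ}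
    (hB : 0 ≤ B) (h : ∫⁻ x in ivSet I, ENNReal.ofReal (u x) ≤ ENNReal.ofReal B) : mass u I ≤ B := by
  unfold mass
  rw [integral_eq_lintegral_of_nonneg_ae (Eventually.of_forall hu) hm.aestronglyMeasurable]
  exact ENNReal.toReal_le_of_le_ofReal hB h

lemma mass_w_le (hr : 1 < r) (ch : ℕ → ℝ × ℝ → Bool) (I : ℝ × ℝ) : mass (wGlob r ch) I ≤ Ctot r :=
  mass_le_of_lint (meas_w r ch) (w_nonneg r ch) (Ctot_nonneg r)
    ((setLIntegral_le_lintegral _ _).trans (w_total hr ch))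

lemma dist_iv {I : ℝ × ℝ} (hx : x ∈ ivSet I) (hy : y ∈ ivSet I) : |x - y| < len I := by
  unfold ivSet at hx hy; unfold len
  rw [abs_lt]
  constructor <;> linarith [hx.1, hx.2, hy.1, hy.2]

lemma lint_shift (f : ℝ → ENNReal) (c : ℝ) (I : ℝ × ℝ) :
    ∫⁻ x in ivSet I, f (x - c) = ∫⁻ x in ivSet (I.1 - c, I.2 - c), f x := by
  have hm : ∀ J, MeasurableSet (ivSet J) := fun J => by unfold ivSet; exact measurableSet_Ico
  rw [← lintegral_indicator (hm _), ← lintegral_indicator (hm _),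
    ← lintegral_sub_right_eq_self ((ivSet (I.1 - c, I.2 - c)).indicator fun x => f x) c]
  congr 1; ext x
  by_cases h : x ∈ ivSet I
  · rw [indicator_of_mem h, indicator_of_mem]
    simpa [ivSet] using h
  · rw [indicator_of_notMem h, indicator_of_notMem]
    simpa [ivSet] using h

lemma avg_mid (hx : At ch x k i) (m : ℕ) {I : ℝ × ℝ} (hxI : x ∈ ivSet I)
    (h1 : 1 / 3 ^ (k * m) / 4 ≤ len I) (h2 : len I < 9 ^ k / 4) :
    avg (wGlob r ch) I ≤ 18 * (k : ℝ) ^ (-r) * aa k ^ m := by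
  have h4 := hx.1
  have ha := aa_pos h4
  have hl : 0 < len I := lt_of_lt_of_le (by positivity) h1
  unfold avg
  rw [div_le_iff₀ hl]
  apply mass_le_of_lint (meas_w r ch) (w_nonneg r ch) (by positivity)
  have hpt : ∀ y ∈ ivSet I, ENNReal.ofReal (wGlob r ch y) ≤
      ENNReal.ofReal ((k : ℝ) ^ (-r)) * ENNReal.ofReal (wgt k (ch k) (y - 9 ^ k)) := by
    intro y hy
    by_cases h : ∃ k i, At ch y k i
    · obtain ⟨k', i', h⟩ := h
      have := hx.near h ((dist_iv hxI hy).trans h2)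
      subst this
      rw [w_at r h, wgt_mem (by omega) h.2, ENNReal.ofReal_mul (by positivity)]
    · push Not at h
      rw [w_not r h]; simp
  have hmI : MeasurableSet (ivSet I) := by unfold ivSet; exact measurableSet_Ico
  refine (setLIntegral_mono' hmI hpt).trans ?_
  have hmw : Measurable (fun y : ℝ => ENNReal.ofReal (wgt k (ch k) (y - 9 ^ k))) :=
    ((meas_wgt (by omega) _).comp (by fun_prop)).ennreal_ofReal
  rw [lintegral_const_mul _ hmw, lint_shift (fun y => ENNReal.ofReal (wgt k (ch k) y))]
  have h5 := wgt_iv (show 4 ≤ k by omega) (ch k) m (I.1 - 9 ^ k, I.2 - 9 ^ k)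
    (by unfold len at *; simpa using h1)
  refine (mul_le_mul_right h5 _).trans ?_
  rw [← ENNReal.ofReal_mul (by positivity)]
  apply ENNReal.ofReal_le_ofReal
  unfold len
  apply le_of_eq
  simp only; ring

lemma near_eq (p r : ℝ) (hx : At ch x k i) {I : ℝ × ℝ} (hxI : x ∈ ivSet I)
    (h : len I < 1 / 3 ^ (k * (i + 1)) / 4) (hy : y ∈ ivSet I) :
    (wGlob r ch y = 0 ∧ sGlob p ch y = 0) ∨
      (wGlob r ch y = wGlob r ch x ∧ sGlob p ch y = sGlob p ch x) := by
  by_cases hh : ∃ k i, At ch y k i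
  · right
    obtain ⟨k', i', hh⟩ := hh
    have h9 := nine_big hx.1
    have hd := (dist_iv hxI hy).trans h
    have hle : (1 : ℝ) / 3 ^ (k * (i + 1)) ≤ 1 := by
      rw [div_le_one (by positivity)]; exact one_le_pow₀ (by norm_num)
    have := hx.near hh (by linarith)
    subst this
    have h4 := hx.1
    have := Glev_sep (by omega) hx.2 hh.2 (by simpa using hd)
    subst this
    rw [w_at r hx, w_at r hh, s_at p hx, s_at p hh]
    exact ⟨rfl, rfl⟩
  · left
    push Not at hh
    exact ⟨w_not r hh, s_not p hh⟩

lemma k_rpow_le (hr : 1 < r) (hk : 4000 ≤ k) : (k : ℝ) ^ (-r) ≤ 1 :=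
  Real.rpow_le_one_of_one_le_of_nonpos (by exact_mod_cast (by omega : 1 ≤ k)) (by linarith)

lemma avg_le (hr : 1 < r) (hx : At ch x k i) {I : ℝ × ℝ} (hxI : x ∈ ivSet I) :
    avg (wGlob r ch) I ≤ (18 + Ctot r) * aa k ^ (i + 1) := by
  have h4 := hx.1
  have ha := aa_pos h4
  have hC := Ctot_nonneg r
  have ha1 : 1 ≤ aa k ^ (i + 1) := one_le_pow₀ (by linarith)
  have hk1 := k_rpow_le hr h4
  have hk0 : 0 ≤ (k : ℝ) ^ (-r) := by positivity
  have hl : 0 < len I := lt_of_le_of_lt (abs_nonneg _) (dist_iv hxI hxI)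
  rcases lt_or_ge (len I) (1 / 3 ^ (k * (i + 1)) / 4) with h | h
  · unfold avg
    rw [div_le_iff₀ hl]
    have : mass (wGlob r ch) I ≤ ∫ y in ivSet I, aa k ^ (i + 1) := by
      unfold mass
      refine setIntegral_mono_on (int_w hr ch I) (by unfold ivSet; simp)
        (by unfold ivSet; exact measurableSet_Ico) fun y hy => ?_
      rcases near_eq 0 r hx hxI h hy with ⟨h1, -⟩ | ⟨h1, -⟩
      · rw [h1]; linarith
      · rw [h1, w_at r hx]; nlinarith
    refine this.trans ?_
    unfold ivSet len at *
    simp only [integral_const, MeasurableSet.univ, measureReal_restrict_apply, univ_inter,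
      Real.volume_real_Ico, smul_eq_mul]
    rw [max_eq_left hl.le, mul_comm]
    gcongr
    nlinarith
  · rcases lt_or_ge (len I) (9 ^ k / 4) with h' | h'
    · refine (avg_mid hx (i + 1) hxI h h').trans ?_
      gcongr
      nlinarith
    · have h9 := nine_big h4
      unfold avg
      rw [div_le_iff₀ hl]
      refine (mass_w_le hr ch I).trans ?_
      have : 1 ≤ aa k ^ (i + 1) * len I := by nlinarith
      nlinarith

end

lemma avg_le_mul {u f : ℝ → ℝ} {I : ℝ × ℝ} {c : ℝ} (hl : 0 < len I)
    (hu : IntegrableOn u (ivSet I)) (hf : IntegrableOn f (ivSet I))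
    (h : ∀ y ∈ ivSet I, u y ≤ c * f y) : avg u I ≤ c * avg f I := by
  unfold avg
  rw [← mul_div_assoc]
  gcongr
  unfold mass
  rw [← integral_const_mul]
  exact setIntegral_mono_on hu (hf.const_mul c) (by unfold ivSet; exact measurableSet_Ico) h

lemma avg_nonneg {u : ℝ → ℝ} (hu : ∀ x, 0 ≤ u x) {I : ℝ × ℝ} (hl : 0 < len I) : 0 ≤ avg u I :=
  div_nonneg (mass_nonneg hu I) hl.le

lemma at_of_w_pos {r : ℝ} {ch : ℕ → ℝ × ℝ → Bool} {I : ℝ × ℝ} (h : 0 < mass (wGlob r ch) I) :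
    ∃ x ∈ ivSet I, ∃ k i, At ch x k i := by
  by_contra hc
  push Not at hc
  have : mass (wGlob r ch) I = 0 := by
    unfold mass
    apply setIntegral_eq_zero_of_forall_eq_zero
    intro x hx
    exact w_not r (hc x hx)
  linarith

lemma second_ineq {p r : ℝ} (hp : 1 < p) (hr : 1 < r) (ch : ℕ → ℝ × ℝ → Bool) {ε : ℝ}
    (hε : 0 < ε) (hε1 : ε < 1) {F : Finset (ℝ × ℝ)} (hG : Good ε F) {L : ℝ × ℝ}
    (hF : ∀ I ∈ F, ivSet I ⊆ ivSet L ∧ 0 < mass (sGlob p ch) I ∧ 0 < mass (wGlob r ch) I) :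
    ∑ I ∈ F, avg (sGlob p ch) I ^ (p / (p - 1)) * avg (wGlob r ch) I * len I ≤
      (18 + Ctot r) * ((p / (p - 1)) * 2 ^ (p / (p - 1)) / (p / (p - 1) - 1)) *
        mass (sGlob p ch) L / (1 - ε) := by
  have hC := Ctot_nonneg r
  set q := p / (p - 1) with hq
  have hp1 : 0 < p - 1 := by linarith
  have hq1 : 1 < q := by rw [hq, lt_div_iff₀ hp1]; linarith
  have hqinv : 1 / q = (p - 1) / p := by rw [hq, one_div_div]
  set σ := sGlob p ch with hσ
  set w := wGlob r ch with hw
  have hs0 : ∀ x, 0 ≤ σ x := s_nonneg p ch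
  set f : ℝ → ℝ := fun x => σ x ^ (1 / q) with hf
  have hf0 : ∀ x, 0 ≤ f x := fun x => Real.rpow_nonneg (hs0 x) _
  have hfm : Measurable f := (meas_s p ch).pow_const _
  have hfi : ∀ I : ℝ × ℝ, IntegrableOn f (ivSet I) := by
    intro I
    refine Measure.integrableOn_of_bounded (M := 1) (by unfold ivSet; simp)
      hfm.aestronglyMeasurable ?_
    refine Eventually.of_forall fun x => ?_
    rw [Real.norm_eq_abs, abs_of_nonneg (hf0 x)]
    exact Real.rpow_le_one (hs0 x) (s_le_one hp ch x) (by positivity)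
  have hfq : (fun x => f x ^ q) = σ := by
    ext x
    simp only [hf]
    rw [← Real.rpow_mul (hs0 x), one_div_mul_cancel (by linarith), Real.rpow_one]
  have key := hG.embed hε hε1 hf0 hfm hq1 (fun I hI => (hF I hI).1) (hfi L)
    (by rw [hfq]; exact int_s hp ch L)
  rw [hfq] at key
  have hpt : ∀ I ∈ F, avg σ I ^ q * avg w I * len I ≤ (18 + Ctot r) * (avg f I ^ q * len I) := by
    intro I hI
    have hl : 0 < len I := by have := hG.pos I hI; unfold len; linarith
    set W := avg w I with hW
    have hW0 : 0 < W := div_pos (hF I hI).2.2 hl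
    have h1 : avg σ I ≤ ((18 + Ctot r) / W) ^ (1 / q) * avg f I := by
      refine avg_le_mul hl (int_s hp ch I) (hfi I) ?_
      intro y hy
      by_cases h : ∃ k i, At ch y k i
      · obtain ⟨k, i, h⟩ := h
        have h2 := avg_le hr h hy
        rw [← hw, ← hW] at h2
        have ha := aa_pos h.1
        have ha0 : 0 < aa k ^ (i + 1) := by positivity
        have h3 : σ y = f y * (1 / aa k ^ (i + 1)) ^ (1 / q) := by
          simp only [hf]
          rw [← Real.mul_rpow (hs0 y) (by positivity), hσ, s_at p h]
          have : (aa k ^ (i + 1)) ^ (1 - p) * (1 / aa k ^ (i + 1)) = (aa k ^ (i + 1)) ^ (-p) := by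
            rw [one_div, ← Real.rpow_neg_one, ← Real.rpow_add ha0]; congr 1; ring
          rw [this, ← Real.rpow_mul ha0.le, hqinv]
          congr 1
          field_simp
          ring
        rw [h3, mul_comm]
        gcongr ?_ * _
        · exact hf0 y
        apply Real.rpow_le_rpow (by positivity) _ (by positivity)
        rw [div_le_div_iff₀ ha0 hW0]
        linarith
      · push Not at h
        rw [hσ, s_not p h]
        have := hf0 y
        positivity
    have h2 : avg σ I ^ q ≤ ((18 + Ctot r) / W) * avg f I ^ q := by
      calc avg σ I ^ q ≤ (((18 + Ctot r) / W) ^ (1 / q) * avg f I) ^ q :=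
            Real.rpow_le_rpow (avg_nonneg hs0 hl) h1 (by linarith)
        _ = _ := by
            rw [Real.mul_rpow (by positivity) (avg_nonneg hf0 hl), ← Real.rpow_mul (by positivity),
              one_div_mul_cancel (by linarith), Real.rpow_one]
    calc avg σ I ^ q * W * len I ≤ ((18 + Ctot r) / W) * avg f I ^ q * W * len I := by gcongr
      _ = _ := by field_simp
  refine (Finset.sum_le_sum hpt).trans ?_
  rw [← Finset.mul_sum]
  calc (18 + Ctot r) * ∑ I ∈ F, avg f I ^ q * len I ≤ (18 + Ctot r) *
      (q * 2 ^ q / (q - 1) * (∫ x in ivSet L, σ x) / (1 - ε)) := by gcongr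
    _ = _ := by unfold mass; ring

lemma small_ineq {p r : ℝ} (hp : 1 < p) (hr : 1 < r) (ch : ℕ → ℝ × ℝ → Bool) {ε : ℝ}
    (hε : 0 < ε) (hε1 : ε < 1) {F : Finset (ℝ × ℝ)} (hG : Good ε F) {L : ℝ × ℝ}
    (hF : ∀ I ∈ F, ivSet I ⊆ ivSet L)
    (hsm : ∀ I ∈ F, ∃ x ∈ ivSet I, ∃ k i, At ch x k i ∧ len I < 1 / 3 ^ (k * (i + 1)) / 4) :
    ∑ I ∈ F, avg (wGlob r ch) I ^ p * avg (sGlob p ch) I * len I ≤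
      ((p + 1) * 2 ^ (p + 1) / (p + 1 - 1)) * mass (wGlob r ch) L / (1 - ε) := by
  set σ := sGlob p ch with hσ
  set w := wGlob r ch with hw
  have hs0 : ∀ x, 0 ≤ σ x := s_nonneg p ch
  have hw0 : ∀ x, 0 ≤ w x := w_nonneg r ch
  have hp1 : 0 < p + 1 := by linarith
  set f : ℝ → ℝ := fun x => w x ^ (1 / (p + 1)) with hf
  have hf0 : ∀ x, 0 ≤ f x := fun x => Real.rpow_nonneg (hw0 x) _
  have hfm : Measurable f := (meas_w r ch).pow_const _
  have hfle : ∀ x, f x ≤ 1 + w x := by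
    intro x
    simp only [hf]
    rcases le_total (w x) 1 with h | h
    · have := Real.rpow_le_one (hw0 x) h (show 0 ≤ 1 / (p + 1) by positivity)
      linarith [hw0 x]
    · have := Real.rpow_le_rpow_of_exponent_le h (show 1 / (p + 1) ≤ 1 by
        rw [div_le_one hp1]; linarith)
      rw [Real.rpow_one] at this
      linarith
  have hfi : ∀ I : ℝ × ℝ, IntegrableOn f (ivSet I) := by
    intro I
    have hg : IntegrableOn (fun x => 1 + w x) (ivSet I) :=
      IntegrableOn.add (by unfold ivSet; simp) (int_w hr ch I)
    refine Integrable.mono' hg hfm.aestronglyMeasurable ?_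
    refine Eventually.of_forall fun x => ?_
    rw [Real.norm_eq_abs, abs_of_nonneg (hf0 x)]
    exact hfle x
  have hfq : (fun x => f x ^ (p + 1)) = w := by
    ext x
    simp only [hf]
    rw [← Real.rpow_mul (hw0 x), one_div_mul_cancel (by linarith), Real.rpow_one]
  have key := hG.embed hε hε1 hf0 hfm (show 1 < p + 1 by linarith) hF (hfi L)
    (by rw [hfq]; exact int_w hr ch L)
  rw [hfq] at key
  refine le_trans (Finset.sum_le_sum ?_) key
  intro I hI
  have hl : 0 < len I := by have := hG.pos I hI; unfold len; linarith
  obtain ⟨x, hx, k, i, hAt, hlt⟩ := hsm I hI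
  have ha := aa_pos hAt.1
  have ha0 : 0 < aa k ^ (i + 1) := by positivity
  have hk0 : (0 : ℝ) < k := by have := hAt.1; exact_mod_cast (by omega : 0 < k)
  have hA : w x = (k : ℝ) ^ (-r) * aa k ^ (i + 1) := w_at r hAt
  have hA0 : 0 < w x := by rw [hA]; positivity
  have hsx : σ x ≤ w x ^ (1 - p) := by
    rw [hσ, s_at p hAt]
    apply Real.rpow_le_rpow_of_nonpos hA0 _ (by linarith)
    rw [hA]
    have := k_rpow_le hr hAt.1
    nlinarith
  have h1 : avg w I ≤ w x ^ (p / (p + 1)) * avg f I := by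
    refine avg_le_mul hl (int_w hr ch I) (hfi I) fun y hy => ?_
    rcases near_eq p r hAt hx hlt hy with ⟨e, -⟩ | ⟨e, -⟩
    · rw [hw, e]; have := hf0 y; positivity
    · simp only [hf]
      rw [hw, e, ← hw, ← Real.rpow_add hA0, ← add_div, div_self hp1.ne', Real.rpow_one]
  have h2 : avg σ I ≤ w x ^ (1 - p - 1 / (p + 1)) * avg f I := by
    refine avg_le_mul hl (int_s hp ch I) (hfi I) fun y hy => ?_
    rcases near_eq p r hAt hx hlt hy with ⟨-, e⟩ | ⟨e1, e2⟩
    · rw [hσ, e]; have := hf0 y; positivity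
    · simp only [hf]
      rw [hσ, hw, e1, e2, ← hw, ← hσ, ← Real.rpow_add hA0, sub_add_cancel]
      exact hsx
  have hf' := avg_nonneg hf0 hl
  gcongr ?_ * len I
  calc avg w I ^ p * avg σ I ≤ (w x ^ (p / (p + 1)) * avg f I) ^ p *
        (w x ^ (1 - p - 1 / (p + 1)) * avg f I) := by
        have := avg_nonneg hw0 hl
        have := avg_nonneg hs0 hl
        gcongr
    _ = (w x ^ (p / (p + 1) * p) * w x ^ (1 - p - 1 / (p + 1))) * (avg f I ^ p * avg f I) := by
        rw [Real.mul_rpow (by positivity) hf', ← Real.rpow_mul hA0.le]; ring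
    _ = _ := by
        rw [← Real.rpow_add hA0, show p / (p + 1) * p + (1 - p - 1 / (p + 1)) = 0 by
          field_simp; ring, Real.rpow_zero, one_mul, Real.rpow_add_one' hf' (by linarith)]

lemma rpow_nine {r : ℝ} (hr : 1 < r) {k : ℕ} (hk : 4000 ≤ k) :
    1 / (9 : ℝ) ^ k ≤ (⌈r⌉₊.factorial : ℝ) * (k : ℝ) ^ (-r) := by
  have hk1 : (1 : ℝ) ≤ k := by exact_mod_cast (by omega : 1 ≤ k)
  have h1 : (k : ℝ) ^ r ≤ (k : ℝ) ^ ⌈r⌉₊ := by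
    rw [← Real.rpow_natCast]
    exact Real.rpow_le_rpow_of_exponent_le hk1 (Nat.le_ceil r)
  have h2 := Real.pow_div_factorial_le_exp (k : ℝ) (by positivity) ⌈r⌉₊
  have h3 : Real.exp k ≤ 9 ^ k := by
    rw [← Real.exp_one_pow]
    gcongr
    linarith [Real.exp_one_lt_d9]
  rw [div_le_iff₀ (by positivity)] at h2
  rw [Real.rpow_neg (by positivity), ← div_eq_mul_inv, div_le_div_iff₀ (by positivity) (by positivity)]
  have hf : (0 : ℝ) < ⌈r⌉₊.factorial := by positivity
  nlinarith

open Classical in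
lemma near_sum {p r : ℝ} (hp : 1 < p) {ch : ℕ → ℝ × ℝ → Bool} {ε : ℝ}
    (hε : 0 < ε) (hε1 : ε < 1) {F : Finset (ℝ × ℝ)} (hG : Good ε F) {x : ℝ} {k i : ℕ}
    (hx : At ch x k i) (m : ℕ) :
    ∑ I ∈ F.filter (fun I => x ∈ ivSet I ∧ 1 / 3 ^ (k * m) / 4 ≤ len I ∧ len I < 9 ^ k / 4),
      avg (wGlob r ch) I ^ p ≤ 6 * k / (1 - ε) * ((18 * (k : ℝ) ^ (-r)) ^ p * (aa k ^ m) ^ p) := by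
  have h1ε : 0 < 1 - ε := by linarith
  have ha := aa_pos hx.1
  have hpt : ∀ m, ∀ I ∈ F, x ∈ ivSet I → 1 / 3 ^ (k * m) / 4 ≤ len I → len I < 9 ^ k / 4 →
      avg (wGlob r ch) I ^ p ≤ (18 * (k : ℝ) ^ (-r)) ^ p * (aa k ^ m) ^ p := by
    intro m I hI hxI h1 h2
    rw [← Real.mul_rpow (by positivity) (by positivity)]
    have hl : 0 < len I := lt_of_lt_of_le (by positivity) h1
    exact Real.rpow_le_rpow (avg_nonneg (w_nonneg r ch) hl) (avg_mid hx m hxI h1 h2) (by linarith)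
  induction m with
  | zero =>
    have hc := hG.count hε hε1 (x := x) (s := 1 / 4) (by norm_num) (2 * k)
    have e : (3 : ℝ) ^ (2 * k) * (1 / 4) = 9 ^ k / 4 := by rw [pow_mul]; norm_num; ring
    rw [e] at hc
    have e2 : (1 : ℝ) / 3 ^ (k * 0) / 4 = 1 / 4 := by simp
    rw [← e2] at hc
    refine (Finset.sum_le_card_nsmul _ _ ((18 * (k : ℝ) ^ (-r)) ^ p * (aa k ^ 0) ^ p) ?_).trans ?_
    · intro I hI
      rw [Finset.mem_filter] at hI
      exact hpt 0 I hI.1 hI.2.1 hI.2.2.1 hI.2.2.2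
    · rw [nsmul_eq_mul]
      gcongr
      refine hc.trans (le_of_eq ?_)
      push_cast; ring
  | succ m ih =>
    have hc := hG.count hε hε1 (x := x) (s := 1 / 3 ^ (k * (m + 1)) / 4) (by positivity) k
    have e : (3 : ℝ) ^ k * (1 / 3 ^ (k * (m + 1)) / 4) = 1 / 3 ^ (k * m) / 4 := by
      rw [pow_step]; field_simp
    rw [e] at hc
    set A := F.filter (fun I => x ∈ ivSet I ∧ 1 / 3 ^ (k * m) / 4 ≤ len I ∧ len I < 9 ^ k / 4)
    set B := F.filter (fun I => x ∈ ivSet I ∧ 1 / 3 ^ (k * (m + 1)) / 4 ≤ len I ∧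
      len I < 1 / 3 ^ (k * m) / 4) with hB
    have h9 := nine_big hx.1
    have hle1 : (1 : ℝ) / 3 ^ (k * m) ≤ 1 := by
      rw [div_le_one (by positivity)]; exact one_le_pow₀ (by norm_num)
    have hBs : ∑ I ∈ B, avg (wGlob r ch) I ^ p ≤
        3 * k / (1 - ε) * ((18 * (k : ℝ) ^ (-r)) ^ p * (aa k ^ (m + 1)) ^ p) := by
      refine (Finset.sum_le_card_nsmul _ _ ((18 * (k : ℝ) ^ (-r)) ^ p * (aa k ^ (m + 1)) ^ p)
        ?_).trans ?_
      · intro I hI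
        rw [hB, Finset.mem_filter] at hI
        exact hpt (m + 1) I hI.1 hI.2.1 hI.2.2.1 (by linarith [hI.2.2.2])
      · rw [nsmul_eq_mul]
        gcongr
    have hsub : F.filter (fun I => x ∈ ivSet I ∧ 1 / 3 ^ (k * (m + 1)) / 4 ≤ len I ∧
        len I < 9 ^ k / 4) ⊆ A ∪ B := by
      intro I hI
      rw [Finset.mem_filter] at hI
      rw [Finset.mem_union, Finset.mem_filter, Finset.mem_filter]
      rcases lt_or_ge (len I) (1 / 3 ^ (k * m) / 4) with h | h
      · right; exact ⟨hI.1, hI.2.1, hI.2.2.1, h⟩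
      · left; exact ⟨hI.1, hI.2.1, h, hI.2.2.2⟩
    have hnn : ∀ I ∈ F, 0 ≤ avg (wGlob r ch) I ^ p := fun I hI =>
      Real.rpow_nonneg (avg_nonneg (w_nonneg r ch) (by have := hG.pos I hI; unfold len; linarith)) _
    have hsum : ∑ I ∈ F.filter (fun I => x ∈ ivSet I ∧ 1 / 3 ^ (k * (m + 1)) / 4 ≤ len I ∧
        len I < 9 ^ k / 4), avg (wGlob r ch) I ^ p ≤
        ∑ I ∈ A, avg (wGlob r ch) I ^ p + ∑ I ∈ B, avg (wGlob r ch) I ^ p := by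
      refine (Finset.sum_le_sum_of_subset_of_nonneg hsub ?_).trans ?_
      · intro I hI _
        rw [Finset.mem_union, Finset.mem_filter, Finset.mem_filter] at hI
        exact hnn I (by tauto)
      · rw [← Finset.sum_union_inter]
        have : 0 ≤ ∑ I ∈ A ∩ B, avg (wGlob r ch) I ^ p := by
          refine Finset.sum_nonneg fun I hI => hnn I ?_
          exact (Finset.mem_filter.1 (Finset.mem_inter.1 hI).1).1
        linarith
    refine hsum.trans ((add_le_add ih hBs).trans ?_)
    have hap : 2 ≤ aa k ^ p := by
      have := Real.rpow_le_rpow_of_exponent_le (show 1 ≤ aa k by linarith) hp.le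
      rw [Real.rpow_one] at this; linarith
    have hstep : (aa k ^ (m + 1)) ^ p = (aa k ^ m) ^ p * aa k ^ p := by
      rw [pow_succ, Real.mul_rpow (by positivity) (by positivity)]
    rw [hstep]
    set D := (18 * (k : ℝ) ^ (-r)) ^ p
    set X := (aa k ^ m) ^ p
    have hD : 0 ≤ D := by positivity
    have hX : 0 ≤ X := by positivity
    have : 0 ≤ 3 * k / (1 - ε) * (D * X) * (aa k ^ p - 2) := by
      apply mul_nonneg (by positivity); linarith
    calc _ = 6 * k / (1 - ε) * (D * (X * aa k ^ p)) - 3 * k / (1 - ε) * (D * X) * (aa k ^ p - 2) := by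
          ring
      _ ≤ _ := by linarith

/-- the constant for large intervals. -/
def Kbig (p r : ℝ) : ℝ := 6 * 18 ^ p + 4 * Ctot r ^ p * (⌈r⌉₊.factorial : ℝ)

open Classical in
lemma point_sum {p r : ℝ} (hp : 1 < p) (hr : 1 < r) (hrp : 1 ≤ r * (p - 1))
    {ch : ℕ → ℝ × ℝ → Bool} {ε : ℝ}
    (hε : 0 < ε) (hε1 : ε < 1) {F : Finset (ℝ × ℝ)} (hG : Good ε F) {x : ℝ} {k i : ℕ}
    (hx : At ch x k i) (hF : ∀ I ∈ F, x ∈ ivSet I → 1 / 3 ^ (k * (i + 1)) / 4 ≤ len I) :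
    ∑ I ∈ F.filter (fun I => x ∈ ivSet I), avg (wGlob r ch) I ^ p ≤
      Kbig p r / (1 - ε) * ((k : ℝ) ^ (-r) * (aa k ^ (i + 1)) ^ p) := by
  have h1ε : 0 < 1 - ε := by linarith
  have ha := aa_pos hx.1
  have h9 := nine_big hx.1
  have hC := Ctot_nonneg r
  have hk1 : (1 : ℝ) ≤ k := by have := hx.1; exact_mod_cast (by omega : 1 ≤ k)
  have h1 := near_sum (r := r) hp hε hε1 hG hx (i + 1)
  set A := F.filter (fun I => x ∈ ivSet I ∧ 1 / 3 ^ (k * (i + 1)) / 4 ≤ len I ∧ len I < 9 ^ k / 4)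
    with hA
  set B := F.filter (fun I => x ∈ ivSet I ∧ 9 ^ k / 4 ≤ len I) with hB
  have hap : 1 ≤ (aa k ^ (i + 1)) ^ p :=
    Real.one_le_rpow (one_le_pow₀ (by linarith)) (by linarith)
  have hnear : 6 * k / (1 - ε) * ((18 * (k : ℝ) ^ (-r)) ^ p * (aa k ^ (i + 1)) ^ p) ≤
      6 * 18 ^ p / (1 - ε) * ((k : ℝ) ^ (-r) * (aa k ^ (i + 1)) ^ p) := by
    have : (k : ℝ) * ((k : ℝ) ^ (-r)) ^ p ≤ (k : ℝ) ^ (-r) := by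
      rw [← Real.rpow_mul (by positivity)]
      nth_rewrite 1 [← Real.rpow_one (k : ℝ)]
      rw [← Real.rpow_add (by linarith)]
      exact Real.rpow_le_rpow_of_exponent_le hk1 (by nlinarith)
    rw [Real.mul_rpow (by norm_num) (by positivity)]
    calc _ = 6 * 18 ^ p / (1 - ε) * ((k : ℝ) * ((k : ℝ) ^ (-r)) ^ p * (aa k ^ (i + 1)) ^ p) := by ring
      _ ≤ _ := by gcongr
  have hfar : ∑ I ∈ B, avg (wGlob r ch) I ^ p ≤
      4 * Ctot r ^ p * (⌈r⌉₊.factorial : ℝ) / (1 - ε) * ((k : ℝ) ^ (-r) * (aa k ^ (i + 1)) ^ p) := by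
    have hs := Good.sum_inv hε hε1 (x := x) (T := 9 ^ k / 4) (by positivity) B.card B rfl
      (hG.mono (Finset.filter_subset _ _)) (fun I hI => (Finset.mem_filter.1 hI).2.1)
      (fun I hI => (Finset.mem_filter.1 hI).2.2)
    have hpt : ∀ I ∈ B, avg (wGlob r ch) I ^ p ≤ Ctot r ^ p * (1 / len I) := by
      intro I hI
      have hl := (Finset.mem_filter.1 hI).2.2
      have hl1 : 1 ≤ len I := by linarith
      have hl0 : 0 < len I := by linarith
      have : avg (wGlob r ch) I ≤ Ctot r / len I := by
        unfold avg; gcongr; exact mass_w_le hr ch I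
      refine (Real.rpow_le_rpow (avg_nonneg (w_nonneg r ch) hl0) this (by linarith)).trans ?_
      rw [Real.div_rpow hC hl0.le, div_eq_mul_one_div]
      gcongr
      have := Real.rpow_le_rpow_of_exponent_le hl1 hp.le
      rwa [Real.rpow_one] at this
    refine (Finset.sum_le_sum hpt).trans ?_
    rw [← Finset.mul_sum]
    have h9k := rpow_nine hr hx.1
    have hCp : 0 ≤ Ctot r ^ p := by positivity
    calc Ctot r ^ p * ∑ I ∈ B, 1 / len I ≤ Ctot r ^ p * (1 / ((1 - ε) * (9 ^ k / 4))) := by gcongr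
      _ = 4 * Ctot r ^ p / (1 - ε) * (1 / 9 ^ k) := by field_simp
      _ ≤ 4 * Ctot r ^ p / (1 - ε) * ((⌈r⌉₊.factorial : ℝ) * (k : ℝ) ^ (-r)) := by gcongr
      _ = 4 * Ctot r ^ p / (1 - ε) * ((⌈r⌉₊.factorial : ℝ) * (k : ℝ) ^ (-r)) * 1 := by ring
      _ ≤ 4 * Ctot r ^ p / (1 - ε) * ((⌈r⌉₊.factorial : ℝ) * (k : ℝ) ^ (-r)) *
          (aa k ^ (i + 1)) ^ p := by gcongr
      _ = _ := by ring
  have hdec : F.filter (fun I => x ∈ ivSet I) = A ∪ B := by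
    ext I
    rw [Finset.mem_union, hA, hB, Finset.mem_filter, Finset.mem_filter, Finset.mem_filter]
    constructor
    · rintro ⟨h1, h2⟩
      rcases lt_or_ge (len I) (9 ^ k / 4) with h | h
      · left; exact ⟨h1, h2, hF I h1 h2, h⟩
      · right; exact ⟨h1, h2, h⟩
    · tauto
  have hdis : Disjoint A B := by
    rw [Finset.disjoint_left]
    intro I hI hI'
    have := (Finset.mem_filter.1 hI).2.2.2
    have := (Finset.mem_filter.1 hI').2.2
    linarith
  rw [hdec, Finset.sum_union hdis]
  refine (add_le_add (h1.trans hnear) hfar).trans (le_of_eq ?_)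
  unfold Kbig; ring

lemma big_ineq {p r : ℝ} (hp : 1 < p) (hr : 1 < r) (hrp : 1 ≤ r * (p - 1))
    (ch : ℕ → ℝ × ℝ → Bool) {ε : ℝ}
    (hε : 0 < ε) (hε1 : ε < 1) {F : Finset (ℝ × ℝ)} (hG : Good ε F) {L : ℝ × ℝ}
    (hF : ∀ I ∈ F, ivSet I ⊆ ivSet L)
    (hbg : ∀ I ∈ F, ∀ x ∈ ivSet I, ∀ k i, At ch x k i → 1 / 3 ^ (k * (i + 1)) / 4 ≤ len I) :
    ∑ I ∈ F, avg (wGlob r ch) I ^ p * avg (sGlob p ch) I * len I ≤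
      Kbig p r * mass (wGlob r ch) L / (1 - ε) := by
  classical
  have hmI : ∀ I, MeasurableSet (ivSet I) := fun I => by unfold ivSet; exact measurableSet_Ico
  have hterm : ∀ I ∈ F, avg (wGlob r ch) I ^ p * avg (sGlob p ch) I * len I =
      ∫ x in ivSet L, (ivSet I).indicator (fun x => avg (wGlob r ch) I ^ p * sGlob p ch x) x := by
    intro I hI
    have hl : 0 < len I := by have := hG.pos I hI; unfold len; linarith
    rw [setIntegral_indicator (hmI I), inter_eq_right.2 (hF I hI), integral_const_mul]
    unfold avg mass
    field_simp
  have hint : ∀ I ∈ F, IntegrableOn ((ivSet I).indicator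
      (fun x => avg (wGlob r ch) I ^ p * sGlob p ch x)) (ivSet L) := fun I hI =>
    Integrable.indicator ((int_s hp ch L).const_mul _) (hmI I)
  rw [Finset.sum_congr rfl hterm, ← integral_finsetSum _ hint]
  calc ∫ x in ivSet L, ∑ I ∈ F, (ivSet I).indicator
        (fun x => avg (wGlob r ch) I ^ p * sGlob p ch x) x
      ≤ ∫ x in ivSet L, Kbig p r / (1 - ε) * wGlob r ch x := by
        refine setIntegral_mono_on (integrable_finsetSum _ hint) ((int_w hr ch L).const_mul _)
          (hmI L) ?_
        intro x _
        by_cases h : ∃ k i, At ch x k i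
        · obtain ⟨k, i, h⟩ := h
          have h1 := point_sum hp hr hrp hε hε1 hG h (fun I hI hxI => hbg I hI x hxI k i h)
          have ha := aa_pos h.1
          have ha0 : 0 < aa k ^ (i + 1) := by positivity
          have e : ∑ I ∈ F, (ivSet I).indicator
              (fun x => avg (wGlob r ch) I ^ p * sGlob p ch x) x =
              (∑ I ∈ F.filter (fun I => x ∈ ivSet I), avg (wGlob r ch) I ^ p) * sGlob p ch x := by
            rw [Finset.sum_mul, Finset.sum_filter]
            refine Finset.sum_congr rfl fun I _ => ?_
            rw [indicator_apply]
          rw [e]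
          refine (mul_le_mul_of_nonneg_right h1 (s_nonneg p ch x)).trans (le_of_eq ?_)
          rw [s_at p h, w_at r h]
          have : (aa k ^ (i + 1)) ^ p * (aa k ^ (i + 1)) ^ (1 - p) = aa k ^ (i + 1) := by
            rw [← Real.rpow_add ha0, add_sub_cancel, Real.rpow_one]
          calc _ = Kbig p r / (1 - ε) * ((k : ℝ) ^ (-r) *
                ((aa k ^ (i + 1)) ^ p * (aa k ^ (i + 1)) ^ (1 - p))) := by ring
            _ = _ := by rw [this]
        · push Not at h
          rw [w_not r h, mul_zero]
          apply le_of_eq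
          apply Finset.sum_eq_zero
          intro I _
          rw [indicator_apply, s_not p h, mul_zero, ite_self]
    _ = _ := by rw [integral_const_mul]; unfold mass; ring

lemma first_ineq {p r : ℝ} (hp : 1 < p) (hr : 1 < r) (hrp : 1 ≤ r * (p - 1))
    (ch : ℕ → ℝ × ℝ → Bool) {ε : ℝ}
    (hε : 0 < ε) (hε1 : ε < 1) {F : Finset (ℝ × ℝ)} (hG : Good ε F) {L : ℝ × ℝ}
    (hF : ∀ I ∈ F, ivSet I ⊆ ivSet L) :
    ∑ I ∈ F, avg (wGlob r ch) I ^ p * avg (sGlob p ch) I * len I ≤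
      ((p + 1) * 2 ^ (p + 1) / (p + 1 - 1) + Kbig p r) * mass (wGlob r ch) L / (1 - ε) := by
  classical
  set P : ℝ × ℝ → Prop := fun I => ∃ x ∈ ivSet I, ∃ k i, At ch x k i ∧
    len I < 1 / 3 ^ (k * (i + 1)) / 4 with hP
  have h1 := small_ineq (F := F.filter P) hp hr ch hε hε1 (hG.mono (Finset.filter_subset _ _))
    (fun I hI => hF I (Finset.mem_filter.1 hI).1) (fun I hI => (Finset.mem_filter.1 hI).2)
  have h2 := big_ineq (F := F.filter (fun I => ¬ P I)) hp hr hrp ch hε hε1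
    (hG.mono (Finset.filter_subset _ _))
    (fun I hI => hF I (Finset.mem_filter.1 hI).1) (fun I hI x hx k i hA => by
      by_contra hc
      push Not at hc
      exact (Finset.mem_filter.1 hI).2 ⟨x, hx, k, i, hA, hc⟩)
  rw [← Finset.sum_filter_add_sum_filter_not F P]
  refine (add_le_add h1 h2).trans (le_of_eq ?_)
  ring

/-- Proposition 4.11 of the paper (global testing conditions): for every martingale
`ε`-sparse family `𝒮` of intervals in `ℝ` and every interval `L`, the localized testing
sums for the pair `(w̃, σ)` are bounded by `C(p)·w̃(L)/(1-ε)` and `C(p)·σ(L)/(1-ε)`. -/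
theorem statement13 (p r : ℝ) (hp : 1 < p) (hr1 : max 1 (1 / (p - 1)) < r)
    (hr2 : r < p / (p - 1)) :
    ∃ C : ℝ, 0 < C ∧ ∀ ch : ℕ → ℝ × ℝ → Bool,
      ∀ ε : ℝ, 0 < ε → ε < 1 → ∀ S : Set (ℝ × ℝ), MSparse ε S →
      ∀ L : ℝ × ℝ, L.1 < L.2 →
        sumTest p (wGlob r ch) (sGlob p ch) {I | I ∈ S ∧ ivSet I ⊆ ivSet L} ≤
          C * mass (wGlob r ch) L / (1 - ε) ∧
        sumTest (p / (p - 1)) (sGlob p ch) (wGlob r ch) {I | I ∈ S ∧ ivSet I ⊆ ivSet L} ≤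
          C * mass (sGlob p ch) L / (1 - ε) := by
  have hr : 1 < r := lt_of_le_of_lt (le_max_left _ _) hr1
  have hp1 : 0 < p - 1 := by linarith
  have hrp : 1 ≤ r * (p - 1) := by
    have := lt_of_le_of_lt (le_max_right _ _) hr1
    rw [div_lt_iff₀ hp1] at this
    exact this.le
  have hq1 : 1 < p / (p - 1) := by rw [lt_div_iff₀ hp1]; linarith
  have hC := Ctot_nonneg r
  set C1 := (p + 1) * 2 ^ (p + 1) / (p + 1 - 1) + Kbig p r with hC1
  set C2 := (18 + Ctot r) * ((p / (p - 1)) * 2 ^ (p / (p - 1)) / (p / (p - 1) - 1)) with hC2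
  have hC10 : 0 < C1 := by
    have : 0 < (p + 1) * (2 : ℝ) ^ (p + 1) / (p + 1 - 1) := by
      apply div_pos
      · have : 0 < p + 1 := by linarith
        positivity
      · linarith
    have : 0 ≤ Kbig p r := by unfold Kbig; positivity
    linarith
  have hC20 : 0 < C2 := by
    have h1 : 0 < p / (p - 1) - 1 := by linarith
    have h2 : 0 < p / (p - 1) := by linarith
    positivity
  refine ⟨C1 + C2, by positivity, ?_⟩
  intro ch ε hε hε1 S hS L hL
  have h1ε : 0 < 1 - ε := by linarith
  have hmw := mass_nonneg (w_nonneg r ch) L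
  have hms := mass_nonneg (s_nonneg p ch) L
  constructor
  · refine reduce (by linarith) (w_nonneg r ch) (s_nonneg p ch) (int_w hr ch) (int_s hp ch) hS
      (by positivity) ?_
    intro F hG hF
    refine (first_ineq hp hr hrp ch hε hε1 hG (fun I hI => (hF I hI).1)).trans ?_
    rw [← hC1]
    gcongr
    linarith
  · refine reduce (by linarith) (s_nonneg p ch) (w_nonneg r ch) (int_s hp ch) (int_w hr ch) hS
      (by positivity) ?_
    intro F hG hF
    refine (second_ineq hp hr ch hε hε1 hG hF).trans ?_
    rw [← hC2]
    gcongr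
    linarith


end RTpaper
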